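/- arXiv:math/0212174 — 3 statements merged into one kernel-verified Lean document; each statement's English description precedes it below -/
import Mathlib

section
/- Let μ be a probability measure on ℝ with μ({0}) = 0. For every λ > 0 such that γ₊(λ) < ∞ one has -c'(-γ₊(λ))₋ ≤ θ₊(λ) ≤ -c'(-γ₊(λ))₊, where c'(·)₋ and c'(·)₊ denote the left and right derivatives of c; in particular both inequalities are equalities when μ({-γ₊(λ)}) = 0. Symmetrically, for every λ > 0 such that γ₋(λ) < ∞ one has c'(γ₋(λ))₊ ≤ θ₋(λ) ≤ c'(γ₋(λ))₋, with equality when μ({γ₋(λ)}) = 0. -/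
open MeasureTheory Set Filter
open scoped ENNReal NNReal Classical

/-- The function `c` of the paper: `c x = ∫_{[0,∞)} min(x,u) μ(du)` for `x ≥ 0`,
`c x = ∫_{(-∞,0)} min(|x|,|u|) μ(du)` for `x < 0`. -/
noncomputable def cfun (μ : Measure ℝ) (x : ℝ) : ℝ :=
  if 0 ≤ x then ∫ u in Ici (0 : ℝ), min x u ∂μ
  else ∫ u in Iio (0 : ℝ), min |x| |u| ∂μ

/-- The slope `(c(λ) - c(-x))/(λ + x)` appearing in the definition of `θ₊, γ₊`. -/
noncomputable def slopePlus (μ : Measure ℝ) (l x : ℝ) : ℝ :=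
  (cfun μ l - cfun μ (-x)) / (l + x)

/-- The slope `(c(x) - c(-λ))/(x + λ)` appearing in the definition of `θ₋, γ₋`. -/
noncomputable def slopeMinus (μ : Measure ℝ) (l x : ℝ) : ℝ :=
  (cfun μ x - cfun μ (-l)) / (x + l)

/-- The set of `x > 0` attaining the infimum in the definition of `γ₊(λ)`. -/
def argminPlus (μ : Measure ℝ) (l : ℝ) : Set ℝ :=
  {x | 0 < x ∧ ∀ y, 0 < y → slopePlus μ l x ≤ slopePlus μ l y}

/-- The set of `x > 0` attaining the supremum in the definition of `γ₋(λ)`. -/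
def argmaxMinus (μ : Measure ℝ) (l : ℝ) : Set ℝ :=
  {x | 0 < x ∧ ∀ y, 0 < y → slopeMinus μ l y ≤ slopeMinus μ l x}

/-- `θ₊(λ) = -inf_{x>0} (c(λ)-c(-x))/(λ+x)` if the infimum is attained, `0` otherwise. -/
noncomputable def thetaPlus (μ : Measure ℝ) (l : ℝ) : ℝ :=
  if (argminPlus μ l).Nonempty then -sInf (slopePlus μ l '' Ioi 0) else 0

/-- `θ₋(λ) = sup_{x>0} (c(x)-c(-λ))/(x+λ)` if the supremum is attained, `0` otherwise. -/
noncomputable def thetaMinus (μ : Measure ℝ) (l : ℝ) : ℝ :=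
  if (argmaxMinus μ l).Nonempty then sSup (slopeMinus μ l '' Ioi 0) else 0

/-- `γ₊(λ)`: the smallest minimiser if the infimum is attained, `∞ = ⊤` otherwise. -/
noncomputable def gammaPlus (μ : Measure ℝ) (l : ℝ) : EReal :=
  if (argminPlus μ l).Nonempty then ((sInf (argminPlus μ l) : ℝ) : EReal) else ⊤

/-- `γ₋(λ)`: the smallest maximiser if the supremum is attained, `∞ = ⊤` otherwise. -/
noncomputable def gammaMinus (μ : Measure ℝ) (l : ℝ) : EReal :=
  if (argmaxMinus μ l).Nonempty then ((sInf (argmaxMinus μ l) : ℝ) : EReal) else ⊤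

/-- `μ₊(λ) = θ₊(λ) + μ([λ,∞))`. -/
noncomputable def muPlus (μ : Measure ℝ) (l : ℝ) : ℝ :=
  thetaPlus μ l + (μ (Ici l)).toReal

/-- `μ₋(λ) = μ((-∞,-λ]) + θ₋(λ)`. -/
noncomputable def muMinus (μ : Measure ℝ) (l : ℝ) : ℝ :=
  (μ (Iic (-l))).toReal + thetaMinus μ l

/-- The truncated first moment over `S`. -/
noncomputable def gfun (μ : Measure ℝ) (S : Set ℝ) (x : ℝ) : ℝ := ∫ u in S, min x |u| ∂μ

lemma integrable_min_abs (ν : Measure ℝ) [IsFiniteMeasure ν] (x : ℝ) :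
    Integrable (fun u : ℝ => min x |u|) ν := by
  refine Integrable.of_bound (C := |x|) ?_ ?_
  · exact (continuous_const.min continuous_abs).aestronglyMeasurable
  · refine Eventually.of_forall fun u => ?_
    rw [Real.norm_eq_abs, abs_le]
    constructor
    · exact le_min (neg_abs_le x) (le_trans (by simp) (abs_nonneg u))
    · exact (min_le_left _ _).trans (le_abs_self x)

lemma gfun_concave (μ : Measure ℝ) [IsFiniteMeasure μ] (S : Set ℝ) :
    ConcaveOn ℝ univ (gfun μ S) := by
  refine ⟨convex_univ, ?_⟩
  intro x _ y _ a b ha hb hab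
  simp only [gfun, smul_eq_mul]
  rw [← integral_const_mul, ← integral_const_mul, ← integral_add
    ((integrable_min_abs _ x).const_mul a) ((integrable_min_abs _ y).const_mul b)]
  refine integral_mono (((integrable_min_abs _ x).const_mul a).add
    ((integrable_min_abs _ y).const_mul b)) (integrable_min_abs _ _) ?_
  intro u
  simp only [Pi.add_apply]
  refine le_min ?_ ?_
  · have h1 := mul_le_mul_of_nonneg_left (min_le_left x |u|) ha
    have h2 := mul_le_mul_of_nonneg_left (min_le_left y |u|) hb
    linarith
  · have h1 := mul_le_mul_of_nonneg_left (min_le_right x |u|) ha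
    have h2 := mul_le_mul_of_nonneg_left (min_le_right y |u|) hb
    have h3 : a * |u| + b * |u| = |u| := by rw [← add_mul, hab, one_mul]
    linarith

lemma gfun_nonneg (μ : Measure ℝ) (S : Set ℝ) {x : ℝ} (hx : 0 ≤ x) : 0 ≤ gfun μ S x :=
  integral_nonneg fun u => le_min hx (abs_nonneg u)

lemma gfun_zero (μ : Measure ℝ) (S : Set ℝ) : gfun μ S 0 = 0 := by
  simp [gfun]

lemma gfun_differentiableAt (μ : Measure ℝ) [IsFiniteMeasure μ] (S : Set ℝ) (x : ℝ)
    (h : ∀ᵐ u ∂(μ.restrict S), |u| ≠ x) : DifferentiableAt ℝ (gfun μ S) x := by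
  have key := hasDerivAt_integral_of_dominated_loc_of_lip (μ := μ.restrict S)
    (F := fun x u => min x |u|) (x₀ := x) (s := univ) (bound := fun _ => (1 : ℝ))
    (F' := fun u => if x < |u| then (1 : ℝ) else 0) univ_mem
    (Eventually.of_forall fun y => (integrable_min_abs _ y).aestronglyMeasurable)
    (integrable_min_abs _ x)
    ((Measurable.ite (measurableSet_lt measurable_const continuous_abs.measurable)
      measurable_const measurable_const).aestronglyMeasurable)
    (Eventually.of_forall fun u => by
      refine LipschitzOnWith.of_dist_le_mul fun a _ b _ => ?_
      simp only [Real.dist_eq]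
      have := abs_min_sub_min_le_max a |u| b |u|
      simpa using this)
    (integrable_const _)
    (by
      filter_upwards [h] with u hu
      rcases lt_or_gt_of_ne hu with h1 | h1
      · rw [if_neg (not_lt.2 h1.le)]
        refine (hasDerivAt_const x |u|).congr_of_eventuallyEq ?_
        filter_upwards [lt_mem_nhds h1] with y hy
        exact min_eq_right hy.le
      · rw [if_pos h1]
        refine (hasDerivAt_id x).congr_of_eventuallyEq ?_
        filter_upwards [gt_mem_nhds h1] with y hy
        exact min_eq_left hy.le)
  exact key.2.differentiableAt

lemma abstract_key (f : ℝ → ℝ) (A l : ℝ) (hl : 0 < l) (hc : ConcaveOn ℝ univ f)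
    (hf0 : f 0 = 0) (hfn : ∀ x, 0 ≤ x → 0 ≤ f x) (hA : 0 ≤ A) (hAf : 0 < A + f l)
    (S : Set ℝ)
    (hS : S = {x | 0 < x ∧ ∀ y, 0 < y → (f y - A) / (y + l) ≤ (f x - A) / (x + l)})
    (hne : S.Nonempty) :
    0 < sInf S ∧ ∃ a b : ℝ, HasDerivWithinAt f a (Ici (sInf S)) (sInf S) ∧
      HasDerivWithinAt f b (Iic (sInf S)) (sInf S) ∧
      a ≤ sSup ((fun y => (f y - A) / (y + l)) '' Ioi 0) ∧
      sSup ((fun y => (f y - A) / (y + l)) '' Ioi 0) ≤ b ∧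
      (DifferentiableAt ℝ f (sInf S) → a = b) := by
  have hcont : Continuous f := continuousOn_univ.1 (hc.continuousOn isOpen_univ)
  obtain ⟨x0, hx0⟩ := hne
  have hx0' := hx0
  rw [hS] at hx0'
  obtain ⟨hx0p, hx0m⟩ := hx0'
  set m := (f x0 - A) / (x0 + l) with hm
  have hsup : sSup ((fun y => (f y - A) / (y + l)) '' Ioi 0) = m := by
    refine IsGreatest.csSup_eq ⟨⟨x0, hx0p, rfl⟩, ?_⟩
    rintro _ ⟨y, hy, rfl⟩
    exact hx0m y hy
  rw [hsup]
  have hle : ∀ y, 0 < y → f y - A ≤ m * (y + l) := fun y hy =>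
    (div_le_iff₀ (by linarith)).1 (hx0m y hy)
  set g := sInf S with hg
  have hbdd : BddBelow S := ⟨0, fun x hx => by rw [hS] at hx; exact hx.1.le⟩
  have hg0 : 0 ≤ g := le_csInf ⟨x0, hx0⟩ fun x hx => by rw [hS] at hx; exact hx.1.le
  have hgeq : f g - A = m * (g + l) := by
    have hcl : IsClosed {x | f x - A = m * (x + l)} :=
      isClosed_eq (by fun_prop) (by fun_prop)
    have hsub : S ⊆ {x | f x - A = m * (x + l)} := by
      intro x hx
      rw [hS] at hx
      have h1 : (f x - A) / (x + l) = m := le_antisymm (hx0m x hx.1) (hx.2 x0 hx0p)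
      have hxl : x + l ≠ 0 := by have := hx.1; positivity
      exact (div_eq_iff hxl).1 h1
    exact closure_minimal hsub hcl (csInf_mem_closure ⟨x0, hx0⟩ hbdd)
  have hgpos : 0 < g := by
    rcases hg0.lt_or_eq with h | h
    · exact h
    · exfalso
      rw [← h, hf0] at hgeq
      have h1 := hle l hl
      have h2 := hfn l hl.le
      nlinarith
  have hsl : ∀ y, 0 < y → f y - f g ≤ m * (y - g) := fun y hy => by
    have := hle y hy
    linarith
  have hint : g ∈ interior (univ : Set ℝ) := by simp
  have hd1 : DifferentiableWithinAt ℝ f (Ioi g) g := by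
    have := (hc.neg.differentiableWithinAt_Ioi_of_mem_interior hint).neg
    simpa using this
  have hd2 : DifferentiableWithinAt ℝ f (Iio g) g := by
    have := (hc.neg.differentiableWithinAt_Iio_of_mem_interior hint).neg
    simpa using this
  refine ⟨hgpos, derivWithin f (Ioi g) g, derivWithin f (Iio g) g,
    hd1.hasDerivWithinAt.Ici_of_Ioi, hd2.hasDerivWithinAt.Iic_of_Iio, ?_, ?_, ?_⟩
  · have ht := (hasDerivWithinAt_iff_tendsto_slope' (by simp)).1 hd1.hasDerivWithinAt
    refine le_of_tendsto ht ?_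
    filter_upwards [self_mem_nhdsWithin] with y hy
    have hy' : g < y := hy
    rw [slope_def_field, div_le_iff₀ (by linarith)]
    exact hsl y (by linarith)
  · have ht := (hasDerivWithinAt_iff_tendsto_slope' (by simp)).1 hd2.hasDerivWithinAt
    refine ge_of_tendsto ht ?_
    filter_upwards [self_mem_nhdsWithin, mem_nhdsWithin_of_mem_nhds (lt_mem_nhds hgpos)] with y hy hy0
    have hy' : y < g := hy
    rw [slope_def_field, le_div_iff_of_neg (by linarith)]
    exact hsl y hy0
  · intro hd
    rw [hd.derivWithin (uniqueDiffWithinAt_Ioi g), hd.derivWithin (uniqueDiffWithinAt_Iio g)]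

lemma cfun_pos_eq (μ : Measure ℝ) {x : ℝ} (hx : 0 ≤ x) : cfun μ x = gfun μ (Ici 0) x := by
  rw [cfun, if_pos hx, gfun]
  refine setIntegral_congr_fun measurableSet_Ici fun u hu => ?_
  simp only [abs_of_nonneg (mem_Ici.1 hu)]

lemma cfun_neg_eq (μ : Measure ℝ) {x : ℝ} (hx : 0 < x) : cfun μ (-x) = gfun μ (Iio 0) x := by
  rw [cfun, if_neg (by linarith), gfun, abs_neg, abs_of_pos hx]

lemma gfun_sum_pos (μ : Measure ℝ) [IsProbabilityMeasure μ] (h0 : μ {0} = 0) (l : ℝ)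
    (hl : 0 < l) : 0 < gfun μ (Ici 0) l + gfun μ (Iio 0) l := by
  have h : gfun μ (Ici 0) l + gfun μ (Iio 0) l = ∫ u, min l |u| ∂μ := by
    have := integral_add_compl (μ := μ) (s := Ici (0 : ℝ)) measurableSet_Ici (integrable_min_abs μ l)
    rw [compl_Ici] at this
    exact this
  rw [h, integral_pos_iff_support_of_nonneg (fun u => le_min hl.le (abs_nonneg u))
    (integrable_min_abs μ l)]
  have hs : Function.support (fun u : ℝ => min l |u|) = {0}ᶜ := by
    ext u
    simp only [Function.mem_support, mem_compl_iff, mem_singleton_iff]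
    constructor
    · rintro h rfl
      exact h (by simp [hl.le])
    · intro h
      exact (lt_min hl (abs_pos.2 h)).ne'
  rw [hs, prob_compl_eq_one_sub (measurableSet_singleton 0), h0]
  simp

/-- for `λ > 0` with `γ₊(λ) < ∞` (i.e. the infimum is attained, and
`γ₊(λ)` is the smallest minimiser `sInf (argminPlus μ λ)`) one has
`-c'(-γ₊(λ))₋ ≤ θ₊(λ) ≤ -c'(-γ₊(λ))₊`, with both equalities when `μ({-γ₊(λ)}) = 0`;
symmetrically for `γ₋, θ₋`.  Here the left (resp. right) derivative of `c` at `a`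
is `derivWithin (cfun μ) (Iic a) a` (resp. `derivWithin (cfun μ) (Ici a) a`). -/
theorem theta_between_one_sided_derivs (μ : Measure ℝ) [IsProbabilityMeasure μ]
    (h0 : μ {0} = 0) (l : ℝ) (hl : 0 < l) :
    ((argminPlus μ l).Nonempty →
      -(derivWithin (cfun μ) (Iic (-sInf (argminPlus μ l))) (-sInf (argminPlus μ l)))
          ≤ thetaPlus μ l ∧
      thetaPlus μ l
          ≤ -(derivWithin (cfun μ) (Ici (-sInf (argminPlus μ l))) (-sInf (argminPlus μ l))) ∧
      (μ {-sInf (argminPlus μ l)} = 0 →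
        thetaPlus μ l
            = -(derivWithin (cfun μ) (Iic (-sInf (argminPlus μ l))) (-sInf (argminPlus μ l))) ∧
        thetaPlus μ l
            = -(derivWithin (cfun μ) (Ici (-sInf (argminPlus μ l))) (-sInf (argminPlus μ l))))) ∧
    ((argmaxMinus μ l).Nonempty →
      derivWithin (cfun μ) (Ici (sInf (argmaxMinus μ l))) (sInf (argmaxMinus μ l))
          ≤ thetaMinus μ l ∧
      thetaMinus μ l
          ≤ derivWithin (cfun μ) (Iic (sInf (argmaxMinus μ l))) (sInf (argmaxMinus μ l)) ∧
      (μ {sInf (argmaxMinus μ l)} = 0 →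
        thetaMinus μ l
            = derivWithin (cfun μ) (Ici (sInf (argmaxMinus μ l))) (sInf (argmaxMinus μ l)) ∧
        thetaMinus μ l
            = derivWithin (cfun μ) (Iic (sInf (argmaxMinus μ l))) (sInf (argmaxMinus μ l)))) := by
  have hpos := gfun_sum_pos μ h0 l hl
  constructor
  · intro hne
    have hsl : ∀ x, 0 < x → slopePlus μ l x
        = -((gfun μ (Iio 0) x - gfun μ (Ici 0) l) / (x + l)) := by
      intro x hx
      rw [slopePlus, cfun_pos_eq μ hl.le, cfun_neg_eq μ hx, ← neg_div, neg_sub, add_comm l x]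
    have hS : argminPlus μ l = {x | 0 < x ∧ ∀ y, 0 < y →
        (gfun μ (Iio 0) y - gfun μ (Ici 0) l) / (y + l)
          ≤ (gfun μ (Iio 0) x - gfun μ (Ici 0) l) / (x + l)} := by
      ext x
      refine and_congr_right fun hx => forall_congr' fun y => imp_congr_right fun hy => ?_
      rw [hsl x hx, hsl y hy, neg_le_neg_iff]
    obtain ⟨hg, a, b, ha, hb, h1, h2, h3⟩ := abstract_key (gfun μ (Iio 0)) (gfun μ (Ici 0) l) l hl
      (gfun_concave μ _) (gfun_zero μ _) (fun x hx => gfun_nonneg μ _ hx)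
      (gfun_nonneg μ _ hl.le) hpos _ hS hne
    have hth : thetaPlus μ l
        = sSup ((fun y => (gfun μ (Iio 0) y - gfun μ (Ici 0) l) / (y + l)) '' Ioi 0) := by
      rw [thetaPlus, if_pos hne, Real.sInf_def, neg_neg]
      congr 1
      ext z
      simp only [Set.mem_neg, mem_image, mem_Ioi]
      refine exists_congr fun x => and_congr_right fun hx => ?_
      rw [hsl x hx, neg_inj]
    rw [← hth] at h1 h2
    set g := sInf (argminPlus μ l) with hgdef
    have hev : cfun μ =ᶠ[nhds (-g)] fun x => gfun μ (Iio 0) (-x) := by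
      filter_upwards [gt_mem_nhds (show -g < 0 by linarith)] with x hx
      have := cfun_neg_eq μ (show 0 < -x by linarith)
      rwa [neg_neg] at this
    have hL : derivWithin (cfun μ) (Iic (-g)) (-g) = -a := by
      refine HasDerivWithinAt.derivWithin ?_ (uniqueDiffWithinAt_Iic _)
      refine HasDerivWithinAt.congr_of_eventuallyEq ?_ (hev.filter_mono nhdsWithin_le_nhds)
        hev.eq_of_nhds
      have := HasDerivWithinAt.scomp_of_eq (h := fun x : ℝ => -x) (-g) ha
        (hasDerivWithinAt_neg (-g) (Iic (-g)))
        (fun x hx => by simp only [mem_Iic, mem_Ici] at *; linarith) (by simp)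
      simpa [Function.comp_def] using this
    have hR : derivWithin (cfun μ) (Ici (-g)) (-g) = -b := by
      refine HasDerivWithinAt.derivWithin ?_ (uniqueDiffWithinAt_Ici _)
      refine HasDerivWithinAt.congr_of_eventuallyEq ?_ (hev.filter_mono nhdsWithin_le_nhds)
        hev.eq_of_nhds
      have := HasDerivWithinAt.scomp_of_eq (h := fun x : ℝ => -x) (-g) hb
        (hasDerivWithinAt_neg (-g) (Ici (-g)))
        (fun x hx => by simp only [mem_Iic, mem_Ici] at *; linarith) (by simp)
      simpa [Function.comp_def] using this
    rw [hL, hR, neg_neg, neg_neg]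
    refine ⟨h1, h2, fun hμ => ?_⟩
    have hab := h3 (gfun_differentiableAt μ _ g (by
      rw [ae_restrict_iff' measurableSet_Iio]
      have : ∀ᵐ u ∂μ, u ≠ -g := by
        rw [ae_iff]; simpa using hμ
      filter_upwards [this] with u hu hu0 h
      rw [abs_of_neg hu0] at h
      exact hu (by linarith)))
    constructor <;> linarith
  · intro hne
    have hsl : ∀ x, 0 < x → slopeMinus μ l x
        = (gfun μ (Ici 0) x - gfun μ (Iio 0) l) / (x + l) := by
      intro x hx
      rw [slopeMinus, cfun_pos_eq μ hx.le, cfun_neg_eq μ hl]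
    have hS : argmaxMinus μ l = {x | 0 < x ∧ ∀ y, 0 < y →
        (gfun μ (Ici 0) y - gfun μ (Iio 0) l) / (y + l)
          ≤ (gfun μ (Ici 0) x - gfun μ (Iio 0) l) / (x + l)} := by
      ext x
      refine and_congr_right fun hx => forall_congr' fun y => imp_congr_right fun hy => ?_
      rw [hsl x hx, hsl y hy]
    obtain ⟨hg, a, b, ha, hb, h1, h2, h3⟩ := abstract_key (gfun μ (Ici 0)) (gfun μ (Iio 0) l) l hl
      (gfun_concave μ _) (gfun_zero μ _) (fun x hx => gfun_nonneg μ _ hx)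
      (gfun_nonneg μ _ hl.le) (by rwa [add_comm]) _ hS hne
    have hth : thetaMinus μ l
        = sSup ((fun y => (gfun μ (Ici 0) y - gfun μ (Iio 0) l) / (y + l)) '' Ioi 0) := by
      rw [thetaMinus, if_pos hne]
      congr 1
      exact image_congr fun x hx => hsl x hx
    rw [← hth] at h1 h2
    set g := sInf (argmaxMinus μ l) with hgdef
    have hev : cfun μ =ᶠ[nhds g] gfun μ (Ici 0) := by
      filter_upwards [lt_mem_nhds hg] with x hx
      exact cfun_pos_eq μ hx.le
    have hR : derivWithin (cfun μ) (Ici g) g = a :=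
      (ha.congr_of_eventuallyEq (hev.filter_mono nhdsWithin_le_nhds)
        hev.eq_of_nhds).derivWithin (uniqueDiffWithinAt_Ici _)
    have hL : derivWithin (cfun μ) (Iic g) g = b :=
      (hb.congr_of_eventuallyEq (hev.filter_mono nhdsWithin_le_nhds)
        hev.eq_of_nhds).derivWithin (uniqueDiffWithinAt_Iic _)
    rw [hL, hR]
    refine ⟨h1, h2, fun hμ => ?_⟩
    have hab := h3 (gfun_differentiableAt μ _ g (by
      rw [ae_restrict_iff' measurableSet_Ici]
      have : ∀ᵐ u ∂μ, u ≠ g := by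
        rw [ae_iff]; simpa using hμ
      filter_upwards [this] with u hu hu0 h
      rw [abs_of_nonneg (mem_Ici.1 hu0)] at h
      exact hu h))
    constructor <;> linarith
end

section
/- Let p > 0. If ∫_ℝ |y|^p ν(dy) < ∞ and ∫_1^∞ z^{p-1} (1/s(z) + 1/|s(-z)|) |c_Y(z) - c_Y(-z)| dz < ∞, then ∫_0^∞ z^{p-1} (ν₊(z) + ν₋(z)) dz < ∞. Conversely, if ∫_0^∞ z^{p-1} (ν₊(z) + ν₋(z)) dz < ∞, then ∫_ℝ |y|^p ν(dy) < ∞ and ∫_1^∞ z^{p-1} |c_Y(z) - c_Y(-z)| / (s(z) + |s(-z)|) dz < ∞. (This is the analytic content of the paper's Theorem on H^p-embeddings: ν₊ and ν₋ are the tail distribution functions of the supremum and of the negative of the infimum of the diffusion stopped by the optimal embedding, so finiteness of ∫_0^∞ z^{p-1}(ν₊(z)+ν₋(z)) dz is equivalent to the embedding being an H^p-embedding.) -/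
open MeasureTheory Set Filter
open scoped ENNReal NNReal Classical

/-- The function `c_Y` of the paper: `c_Y y = ∫_{[0,∞)} min(s(y),s(w)) ν(dw)` for `y ≥ 0`,
`c_Y y = ∫_{(-∞,0)} min(|s(y)|,|s(w)|) ν(dw)` for `y < 0`. -/
noncomputable def cY (s : ℝ → ℝ) (ν : Measure ℝ) (y : ℝ) : ℝ :=
  if 0 ≤ y then ∫ w in Ici (0 : ℝ), min (s y) (s w) ∂ν
  else ∫ w in Iio (0 : ℝ), min |s y| |s w| ∂ν

/-- The slope `(c_Y(z) - c_Y(-y))/(s(z) - s(-y))` in the definition of `ζ₊, ρ₊`. -/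
noncomputable def slopeYPlus (s : ℝ → ℝ) (ν : Measure ℝ) (z y : ℝ) : ℝ :=
  (cY s ν z - cY s ν (-y)) / (s z - s (-y))

/-- The slope `(c_Y(y) - c_Y(-z))/(s(y) - s(-z))` in the definition of `ζ₋, ρ₋`. -/
noncomputable def slopeYMinus (s : ℝ → ℝ) (ν : Measure ℝ) (z y : ℝ) : ℝ :=
  (cY s ν y - cY s ν (-z)) / (s y - s (-z))

/-- The set of `y > 0` attaining the infimum in the definition of `ρ₊(z)`. -/
def argYPlus (s : ℝ → ℝ) (ν : Measure ℝ) (z : ℝ) : Set ℝ :=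
  {y | 0 < y ∧ ∀ x, 0 < x → slopeYPlus s ν z y ≤ slopeYPlus s ν z x}

/-- The set of `y > 0` attaining the supremum in the definition of `ρ₋(z)`. -/
def argYMinus (s : ℝ → ℝ) (ν : Measure ℝ) (z : ℝ) : Set ℝ :=
  {y | 0 < y ∧ ∀ x, 0 < x → slopeYMinus s ν z x ≤ slopeYMinus s ν z y}

/-- `ζ₊(z) = -inf_{y>0} (c_Y(z)-c_Y(-y))/(s(z)-s(-y))` if attained, `0` otherwise. -/
noncomputable def zetaPlus (s : ℝ → ℝ) (ν : Measure ℝ) (z : ℝ) : ℝ :=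
  if (argYPlus s ν z).Nonempty then -sInf (slopeYPlus s ν z '' Ioi 0) else 0

/-- `ζ₋(z) = sup_{y>0} (c_Y(y)-c_Y(-z))/(s(y)-s(-z))` if attained, `0` otherwise. -/
noncomputable def zetaMinus (s : ℝ → ℝ) (ν : Measure ℝ) (z : ℝ) : ℝ :=
  if (argYMinus s ν z).Nonempty then sSup (slopeYMinus s ν z '' Ioi 0) else 0

/-- `ν₊(z) = ζ₊(z) + ν([z,∞))`, the tail distribution function of the supremum of the
stopped process for the optimal embedding. -/
noncomputable def nuPlus (s : ℝ → ℝ) (ν : Measure ℝ) (z : ℝ) : ℝ :=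
  zetaPlus s ν z + (ν (Ici z)).toReal

/-- `ν₋(z) = ν((-∞,-z]) + ζ₋(z)`, the tail distribution function of minus the infimum of
the stopped process for the optimal embedding. -/
noncomputable def nuMinus (s : ℝ → ℝ) (ν : Measure ℝ) (z : ℝ) : ℝ :=
  (ν (Iic (-z))).toReal + zetaMinus s ν z

structure GoodC (c g T : ℝ → ℝ) : Prop where
  cc : Continuous c
  gc : Continuous g
  g0 : g 0 = 0
  c0 : c 0 = 0
  gm : StrictMonoOn g (Ici 0)
  cm : ∀ x y, 0 ≤ x → x ≤ y → c x ≤ c y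
  ct : ∀ x y, 0 ≤ x → x ≤ y → c y ≤ c x + (g y - g x) * T x
  T0 : ∀ x, 0 ≤ T x
  T1 : ∀ x, T x ≤ 1
  Tl : Tendsto T atTop (nhds 0)

lemma GoodC.gpos {c g T : ℝ → ℝ} (h : GoodC c g T) {x : ℝ} (hx : 0 < x) : 0 < g x := by
  have := h.gm (mem_Ici.2 le_rfl) (mem_Ici.2 hx.le) hx
  rwa [h.g0] at this

lemma GoodC.gnn {c g T : ℝ → ℝ} (h : GoodC c g T) {x : ℝ} (hx : 0 ≤ x) : 0 ≤ g x := by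
  rcases hx.eq_or_lt with h1 | h1
  · rw [← h1, h.g0]
  · exact (h.gpos h1).le

lemma GoodC.cnn {c g T : ℝ → ℝ} (h : GoodC c g T) {x : ℝ} (hx : 0 ≤ x) : 0 ≤ c x := by
  have := h.cm 0 x le_rfl hx
  rwa [h.c0] at this

lemma GoodC.attain {c g T : ℝ → ℝ} (h : GoodC c g T) {A B : ℝ} (hA : 0 < A) (hB : 0 ≤ B)
    {y0 : ℝ} (hy0 : 0 < y0) (hr : 0 < (c y0 - B) / (A + g y0)) :
    ∃ y, 0 < y ∧ ∀ x, 0 < x → (c x - B) / (A + g x) ≤ (c y - B) / (A + g y) := by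
  obtain ⟨M, hM0, hMT⟩ := ((eventually_ge_atTop y0).and (h.Tl.eventually (gt_mem_nhds hr))).exists
  have hco : ContinuousOn (fun x => (c x - B) / (A + g x)) (Icc 0 M) := by
    apply ContinuousOn.div
    · exact (h.cc.sub continuous_const).continuousOn
    · exact (continuous_const.add h.gc).continuousOn
    · intro x hx
      have := h.gnn hx.1
      positivity
  obtain ⟨y, hy, hmax⟩ := isCompact_Icc.exists_isMaxOn ⟨0, by constructor <;> linarith⟩ hco
  have hmax' : ∀ x ∈ Icc 0 M, (c x - B) / (A + g x) ≤ (c y - B) / (A + g y) := hmax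
  have h1 := hmax' y0 ⟨hy0.le, hM0⟩
  refine ⟨y, ?_, ?_⟩
  · rcases hy.1.eq_or_lt with h2 | h2
    · exfalso
      rw [← h2, h.c0, h.g0] at h1
      have : (0 - B) / (A + 0) ≤ 0 := div_nonpos_of_nonpos_of_nonneg (by linarith) (by linarith)
      linarith
    · exact h2
  · intro x hx
    rcases le_total x M with hxM | hxM
    · exact hmax' x ⟨hx.le, hxM⟩
    · have hM := hmax' M ⟨by linarith, le_rfl⟩
      set R := (c y - B) / (A + g y)
      have hMp : 0 < M := by linarith
      have h3 := h.ct M x hMp.le hxM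
      have gM := h.gpos hMp
      have gx : g M ≤ g x := h.gm.monotoneOn (mem_Ici.2 hMp.le) (mem_Ici.2 hx.le) hxM
      rw [div_le_iff₀ (by positivity)] at hM
      rw [div_le_iff₀ (by linarith)]
      have h4 : T M ≤ R := by linarith
      nlinarith [mul_le_mul_of_nonneg_left h4 (sub_nonneg.2 gx)]

/-- `Z` is the attained maximum, or zero. -/
def IsZ (r : ℝ → ℝ) (Z : ℝ) : Prop :=
  (∃ y, 0 < y ∧ (∀ x, 0 < x → r x ≤ r y) ∧ Z = r y) ∨
    ((¬ ∃ y, 0 < y ∧ ∀ x, 0 < x → r x ≤ r y) ∧ Z = 0)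

lemma GoodC.Z_nonneg {c g T : ℝ → ℝ} (h : GoodC c g T) {A B Z : ℝ} (hA : 0 < A)
    (hZ : IsZ (fun x => (c x - B) / (A + g x)) Z) : 0 ≤ Z := by
  rcases hZ with ⟨y, hy, hm, rfl⟩ | ⟨_, rfl⟩
  · by_contra! hneg
    have h1 := hm (y + 1) (by linarith)
    have gy := h.gpos hy
    have gx := h.gm (mem_Ici.2 hy.le) (mem_Ici.2 (by linarith : (0:ℝ) ≤ y + 1)) (by linarith)
    have hc := h.cm y (y+1) hy.le (by linarith)
    dsimp only at h1 hneg
    rw [div_le_div_iff₀ (by linarith) (by linarith)] at h1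
    rw [div_lt_iff₀ (by linarith)] at hneg
    nlinarith
  · exact le_rfl

lemma GoodC.Z_lower {c g T : ℝ → ℝ} (h : GoodC c g T) {A B Z : ℝ} (hA : 0 < A) (hB : 0 ≤ B)
    (hZ : IsZ (fun x => (c x - B) / (A + g x)) Z) {z : ℝ} (hz : 0 < z) :
    (c z - B) / (A + g z) ≤ Z := by
  have h0 := h.Z_nonneg hA hZ
  by_contra! hlt
  have h1 := h.attain hA hB hz (by linarith)
  rcases hZ with ⟨y, hy, hm, rfl⟩ | ⟨hn, rfl⟩
  · exact absurd (hm z hz) (not_le.2 hlt)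
  · exact hn h1

lemma GoodC.Z_le_one {c g T : ℝ → ℝ} (h : GoodC c g T) {A B Z : ℝ} (hA : 0 < A) (hB : 0 ≤ B)
    (hZ : IsZ (fun x => (c x - B) / (A + g x)) Z) : Z ≤ 1 := by
  rcases hZ with ⟨y, hy, hm, rfl⟩ | ⟨_, rfl⟩
  · have gy := h.gpos hy
    have := h.ct 0 y le_rfl hy.le
    rw [h.c0, h.g0] at this
    dsimp only
    rw [div_le_one (by linarith)]
    nlinarith [h.T1 0]
  · norm_num

lemma GoodC.Z_upper {c g T : ℝ → ℝ} (h : GoodC c g T) {A B Z : ℝ} (hA : 0 < A)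
    (hZ : IsZ (fun x => (c x - B) / (A + g x)) Z) {z : ℝ} (hz : 0 < z) :
    Z ≤ 1 / A * |B - c z| + T z := by
  have hT := h.T0 z
  rcases hZ with ⟨y, hy, hm, rfl⟩ | ⟨_, rfl⟩
  · have gy := h.gpos hy
    have gz := h.gpos hz
    dsimp only
    rw [div_le_iff₀ (by linarith)]
    have h1 : c y ≤ c z + g y * T z := by
      rcases le_total z y with hzy | hzy
      · have := h.ct z y hz.le hzy
        nlinarith
      · have := h.cm y z hy.le hzy
        nlinarith
    have h2 : |B - c z| ≤ 1 / A * |B - c z| * (A + g y) := by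
      have : 1 / A * |B - c z| * (A + g y) = |B - c z| + |B - c z| * g y / A := by
        field_simp
      rw [this]
      have : 0 ≤ |B - c z| * g y / A := by positivity
      linarith
    have h3 : c z - B ≤ |B - c z| := by rw [abs_sub_comm]; exact le_abs_self _
    nlinarith
  · positivity

lemma goodC_of (μ : Measure ℝ) [IsFiniteMeasure μ] (hμ : μ.real univ ≤ 1) (k g T : ℝ → ℝ)
    (hk : Measurable k) (hk0 : ∀ᵐ w ∂μ, 0 ≤ k w) (gc : Continuous g) (g0 : g 0 = 0)
    (gm : StrictMonoOn g (Ici 0)) (hT : ∀ x, 0 ≤ x → μ.real {w | g x ≤ k w} ≤ T x)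
    (T0 : ∀ x, 0 ≤ T x)
    (T1 : ∀ x, T x ≤ 1) (Tl : Tendsto T atTop (nhds 0)) :
    GoodC (fun y => ∫ w, min (g y) (k w) ∂μ) g T := by
  have hint : ∀ u : ℝ, Integrable (fun w => min u (k w)) μ := by
    intro u
    apply (integrable_const |u|).mono' (measurable_const.min hk).aestronglyMeasurable
    filter_upwards [hk0] with w hw
    rw [Real.norm_eq_abs]
    rcases le_total u (k w) with h | h
    · rw [min_eq_left h]
    · rw [min_eq_right h, abs_of_nonneg hw]; exact h.trans (le_abs_self u)
  have gmono : ∀ x y, 0 ≤ x → x ≤ y → g x ≤ g y := fun x y hx hxy =>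
    gm.monotoneOn (mem_Ici.2 hx) (mem_Ici.2 (hx.trans hxy)) hxy
  refine ⟨?_, gc, g0, ?_, gm, ?_, ?_, T0, T1, Tl⟩
  · have : LipschitzWith 1 (fun u : ℝ => ∫ w, min u (k w) ∂μ) := by
      apply LipschitzWith.of_dist_le_mul
      intro u v
      rw [Real.dist_eq, Real.dist_eq, ← integral_sub (hint u) (hint v), ← Real.norm_eq_abs]
      have h1 := norm_integral_le_of_norm_le_const (μ := μ) (C := |u - v|)
        (f := fun w => min u (k w) - min v (k w))
        (Eventually.of_forall fun w => by
          have := abs_min_sub_min_le_max u (k w) v (k w)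
          simpa using this)
      refine h1.trans ?_
      simp only [NNReal.coe_one, one_mul]
      nlinarith [abs_nonneg (u - v)]
    exact this.continuous.comp gc
  · show ∫ w, min (g 0) (k w) ∂μ = 0
    rw [g0]
    apply integral_eq_zero_of_ae
    filter_upwards [hk0] with w hw
    simp [hw]
  · intro x y hx hxy
    exact integral_mono (hint _) (hint _) fun w => min_le_min_right _ (gmono x y hx hxy)
  · intro x y hx hxy
    have hg := gmono x y hx hxy
    have hms : MeasurableSet {w | g x ≤ k w} := measurableSet_le measurable_const hk
    have hi2 : Integrable (({w | g x ≤ k w}).indicator (fun _ => g y - g x)) μ :=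
      (integrable_const _).indicator hms
    calc ∫ w, min (g y) (k w) ∂μ
        ≤ ∫ w, (min (g x) (k w) + ({w | g x ≤ k w}).indicator (fun _ => g y - g x) w) ∂μ := by
          apply integral_mono (hint _) ((hint _).add hi2)
          intro w
          show min (g y) (k w) ≤ min (g x) (k w) +
            ({w | g x ≤ k w}).indicator (fun _ => g y - g x) w
          by_cases hw : g x ≤ k w
          · rw [indicator_of_mem (show w ∈ {w | g x ≤ k w} from hw), min_eq_left hw]
            linarith [min_le_left (g y) (k w)]
          · rw [indicator_of_notMem (show w ∉ {w | g x ≤ k w} from hw)]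
            push Not at hw
            rw [min_eq_right hw.le, min_eq_right (hw.le.trans hg)]
            simp
      _ = ∫ w, min (g x) (k w) ∂μ + (g y - g x) * μ.real {w | g x ≤ k w} := by
          rw [integral_add (hint _) hi2, integral_indicator_const _ hms, smul_eq_mul, mul_comm]
      _ ≤ _ := by
          have := mul_le_mul_of_nonneg_left (hT x hx) (sub_nonneg.2 hg)
          linarith

lemma tendsto_tail_plus (ν : Measure ℝ) [IsProbabilityMeasure ν] :
    Tendsto (fun x => ν.real (Ici x)) atTop (nhds 0) := by
  have h := tendsto_measure_iInter_atTop (μ := ν) (s := fun x : ℝ => Ici x)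
    (fun i => measurableSet_Ici.nullMeasurableSet) (fun a b hab => Ici_subset_Ici.2 hab)
    ⟨0, measure_ne_top _ _⟩
  have he : (⋂ n : ℝ, Ici n) = ∅ := by
    ext x
    simp only [mem_iInter, mem_Ici, mem_empty_iff_false, iff_false, not_forall, not_le]
    exact ⟨x + 1, by linarith⟩
  rw [he, measure_empty] at h
  have := (ENNReal.tendsto_toReal ENNReal.zero_ne_top).comp h
  exact this

lemma tendsto_tail_minus (ν : Measure ℝ) [IsProbabilityMeasure ν] :
    Tendsto (fun x => ν.real (Iic (-x))) atTop (nhds 0) := by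
  have h := tendsto_measure_iInter_atTop (μ := ν) (s := fun x : ℝ => Iic (-x))
    (fun i => measurableSet_Iic.nullMeasurableSet)
    (fun a b hab => Iic_subset_Iic.2 (neg_le_neg hab))
    ⟨0, measure_ne_top _ _⟩
  have he : (⋂ n : ℝ, Iic (-n)) = ∅ := by
    ext x
    simp only [mem_iInter, mem_Iic, mem_empty_iff_false, iff_false, not_forall, not_le]
    exact ⟨-x + 1, by linarith⟩
  rw [he, measure_empty] at h
  have := (ENNReal.tendsto_toReal ENNReal.zero_ne_top).comp h
  exact this

lemma good_plus (s : ℝ → ℝ) (hs : Continuous s) (hmono : StrictMono s) (hs0 : s 0 = 0)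
    (ν : Measure ℝ) [IsProbabilityMeasure ν] :
    GoodC (fun y => ∫ w in Ici (0 : ℝ), min (s y) (s w) ∂ν) s (fun x => ν.real (Ici x)) := by
  apply goodC_of (ν.restrict (Ici 0)) _ s s _ hs.measurable _ hs hs0 (hmono.strictMonoOn _) _
    (fun x => measureReal_nonneg) (fun x => measureReal_le_one) (tendsto_tail_plus ν)
  · rw [measureReal_restrict_apply MeasurableSet.univ]; exact measureReal_le_one
  · rw [ae_restrict_iff' measurableSet_Ici]
    refine Eventually.of_forall fun w hw => ?_
    rw [← hs0]; exact hmono.monotone hw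
  · intro x hx
    rw [measureReal_restrict_apply (measurableSet_le measurable_const hs.measurable)]
    refine measureReal_mono ?_ (measure_ne_top _ _)
    rintro w ⟨h1, h2⟩
    exact hmono.le_iff_le.1 h1

lemma good_minus (s : ℝ → ℝ) (hs : Continuous s) (hmono : StrictMono s) (hs0 : s 0 = 0)
    (ν : Measure ℝ) [IsProbabilityMeasure ν] :
    GoodC (fun y => ∫ w in Iio (0 : ℝ), min |s (-y)| |s w| ∂ν) (fun y => |s (-y)|)
      (fun x => ν.real (Iic (-x))) := by
  have habs : ∀ w, w ≤ 0 → |s w| = - s w := fun w hw => abs_of_nonpos (by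
    rw [← hs0]; exact hmono.monotone hw)
  apply goodC_of (ν.restrict (Iio 0)) _ (fun w => |s w|) (fun y => |s (-y)|) _
    hs.abs.measurable _ (by fun_prop) (by simp [hs0]) _ _
    (fun x => measureReal_nonneg) (fun x => measureReal_le_one) (tendsto_tail_minus ν)
  · rw [measureReal_restrict_apply MeasurableSet.univ]; exact measureReal_le_one
  · exact Eventually.of_forall fun w => abs_nonneg _
  · intro x hx y hy hxy
    show |s (-x)| < |s (-y)|
    rw [habs _ (by simpa using hx), habs _ (by simpa using hy)]
    exact neg_lt_neg (hmono (by linarith))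
  · intro x hx
    rw [measureReal_restrict_apply (measurableSet_le measurable_const hs.abs.measurable)]
    refine measureReal_mono ?_ (measure_ne_top _ _)
    rintro w ⟨h1, h2⟩
    have h1' : |s (-x)| ≤ |s w| := h1
    rw [habs _ (by linarith), habs _ (le_of_lt h2)] at h1'
    exact hmono.le_iff_le.1 (by linarith)

lemma cY_pos (s : ℝ → ℝ) (ν : Measure ℝ) {y : ℝ} (hy : 0 < y) :
    cY s ν y = ∫ w in Ici (0 : ℝ), min (s y) (s w) ∂ν := by
  rw [cY, if_pos hy.le]

lemma cY_neg (s : ℝ → ℝ) (ν : Measure ℝ) {y : ℝ} (hy : 0 < y) :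
    cY s ν (-y) = ∫ w in Iio (0 : ℝ), min |s (-y)| |s w| ∂ν := by
  rw [cY, if_neg (by linarith)]

lemma isZ_plus (s : ℝ → ℝ) (hmono : StrictMono s) (hs0 : s 0 = 0)
    (ν : Measure ℝ) (z : ℝ) :
    IsZ (fun y => ((∫ w in Iio (0 : ℝ), min |s (-y)| |s w| ∂ν) - cY s ν z) / (s z + |s (-y)|))
      (zetaPlus s ν z) := by
  set r := (fun y => ((∫ w in Iio (0 : ℝ), min |s (-y)| |s w| ∂ν) - cY s ν z) / (s z + |s (-y)|))
    with hr
  have hrs : ∀ y, 0 < y → slopeYPlus s ν z y = - r y := by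
    intro y hy
    have : s (-y) < 0 := by rw [← hs0]; exact hmono (by linarith)
    simp only [slopeYPlus, hr]
    rw [← cY_neg s ν hy, abs_of_neg this]
    rw [← neg_div]
    ring_nf
  by_cases h : (argYPlus s ν z).Nonempty
  · left
    obtain ⟨y, hy, hm⟩ := id h
    refine ⟨y, hy, ?_, ?_⟩
    · intro x hx
      have := hm x hx
      rw [hrs x hx, hrs y hy] at this
      linarith
    · rw [zetaPlus, if_pos h]
      have : IsLeast (slopeYPlus s ν z '' Ioi 0) (slopeYPlus s ν z y) :=
        ⟨mem_image_of_mem _ hy, by rintro _ ⟨x, hx, rfl⟩; exact hm x hx⟩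
      rw [this.csInf_eq, hrs y hy, neg_neg]
  · right
    refine ⟨?_, by rw [zetaPlus, if_neg h]⟩
    rintro ⟨y, hy, hm⟩
    refine h ⟨y, hy, fun x hx => ?_⟩
    rw [hrs x hx, hrs y hy]
    linarith [hm x hx]

lemma isZ_minus (s : ℝ → ℝ) (hmono : StrictMono s) (hs0 : s 0 = 0)
    (ν : Measure ℝ) (z : ℝ) (hz : 0 < z) :
    IsZ (fun y => ((∫ w in Ici (0 : ℝ), min (s y) (s w) ∂ν) - cY s ν (-z)) / (|s (-z)| + s y))
      (zetaMinus s ν z) := by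
  set r := (fun y => ((∫ w in Ici (0 : ℝ), min (s y) (s w) ∂ν) - cY s ν (-z)) / (|s (-z)| + s y))
    with hr
  have hrs : ∀ y, 0 < y → slopeYMinus s ν z y = r y := by
    intro y hy
    have : s (-z) < 0 := by rw [← hs0]; exact hmono (by linarith)
    simp only [slopeYMinus, hr, ← cY_pos s ν hy, abs_of_neg this]
    ring_nf
  by_cases h : (argYMinus s ν z).Nonempty
  · left
    obtain ⟨y, hy, hm⟩ := id h
    refine ⟨y, hy, ?_, ?_⟩
    · intro x hx
      have := hm x hx
      rwa [hrs x hx, hrs y hy] at this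
    · rw [zetaMinus, if_pos h]
      have : IsGreatest (slopeYMinus s ν z '' Ioi 0) (slopeYMinus s ν z y) :=
        ⟨mem_image_of_mem _ hy, by rintro _ ⟨x, hx, rfl⟩; exact hm x hx⟩
      rw [this.csSup_eq, hrs y hy]
  · right
    refine ⟨?_, by rw [zetaMinus, if_neg h]⟩
    rintro ⟨y, hy, hm⟩
    refine h ⟨y, hy, fun x hx => ?_⟩
    rw [hrs x hx, hrs y hy]
    exact hm x hx

lemma zeta_key (s : ℝ → ℝ) (hs : Continuous s) (hmono : StrictMono s) (hs0 : s 0 = 0)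
    (ν : Measure ℝ) [IsProbabilityMeasure ν] (z : ℝ) (hz : 0 < z) :
    0 ≤ zetaPlus s ν z ∧ 0 ≤ zetaMinus s ν z ∧ zetaPlus s ν z ≤ 1 ∧ zetaMinus s ν z ≤ 1 ∧
    zetaPlus s ν z + zetaMinus s ν z ≤
      (1 / s z + 1 / |s (-z)|) * |cY s ν z - cY s ν (-z)| +
        (ν.real (Ici z) + ν.real (Iic (-z))) ∧
    |cY s ν z - cY s ν (-z)| / (s z + |s (-z)|) ≤ zetaPlus s ν z + zetaMinus s ν z := by
  have gp := good_plus s hs hmono hs0 ν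
  have gm := good_minus s hs hmono hs0 ν
  have zp := isZ_plus s hmono hs0 ν z
  have zm := isZ_minus s hmono hs0 ν z hz
  have hA : 0 < s z := gp.gpos hz
  have hA' : 0 < |s (-z)| := gm.gpos hz
  have hB : 0 ≤ cY s ν z := by rw [cY_pos s ν hz]; exact gp.cnn hz.le
  have hB' : 0 ≤ cY s ν (-z) := by rw [cY_neg s ν hz]; exact gm.cnn hz.le
  have n1 := gm.Z_nonneg hA zp
  have n2 := gp.Z_nonneg hA' zm
  have l1 := gm.Z_lower hA hB zp hz
  have l2 := gp.Z_lower hA' hB' zm hz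
  have u1 := gm.Z_upper hA zp hz
  have u2 := gp.Z_upper hA' zm hz
  simp only [← cY_pos s ν hz, ← cY_neg s ν hz] at l1 l2 u1 u2
  refine ⟨n1, n2, gm.Z_le_one hA hB zp, gp.Z_le_one hA' hB' zm, ?_, ?_⟩
  · rw [abs_sub_comm (cY s ν (-z))] at u2
    linarith
  · rcases abs_cases (cY s ν z - cY s ν (-z)) with ⟨h, _⟩ | ⟨h, _⟩
    · rw [h, add_comm (s z)]
      linarith
    · rw [h, neg_sub]
      linarith

lemma tail_int (ν : Measure ℝ) [IsProbabilityMeasure ν] (p : ℝ) (hp : 0 < p) :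
    ∫⁻ y, ENNReal.ofReal (|y| ^ p) ∂ν < ⊤ ↔
    ∫⁻ z in Ioi (0 : ℝ), ENNReal.ofReal
      (z ^ (p - 1) * (ν.real (Ici z) + ν.real (Iic (-z)))) < ⊤ := by
  rw [lintegral_rpow_eq_lintegral_meas_le_mul ν (f := fun y : ℝ => |y|)
    (Eventually.of_forall fun y => abs_nonneg y) continuous_abs.measurable.aemeasurable hp]
  have : ∫⁻ t in Ioi 0, ν {a : ℝ | t ≤ |a|} * ENNReal.ofReal (t ^ (p - 1)) =
      ∫⁻ z in Ioi (0 : ℝ), ENNReal.ofReal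
      (z ^ (p - 1) * (ν.real (Ici z) + ν.real (Iic (-z)))) := by
    apply setLIntegral_congr_fun measurableSet_Ioi
    intro t ht
    have ht' : (0:ℝ) < t := ht
    have h1 : {a : ℝ | t ≤ |a|} = Ici t ∪ Iic (-t) := by
      ext a
      show t ≤ |a| ↔ (t ≤ a ∨ a ≤ -t)
      rw [le_abs, le_neg]
    have h2 : Disjoint (Ici t) (Iic (-t)) := by
      rw [Set.disjoint_left]
      intro a ha hb
      have ha' : t ≤ a := ha
      have hb' : a ≤ -t := hb
      linarith
    show ν {a : ℝ | t ≤ |a|} * ENNReal.ofReal (t ^ (p - 1)) =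
      ENNReal.ofReal (t ^ (p - 1) * (ν.real (Ici t) + ν.real (Iic (-t))))
    rw [← measureReal_union (μ := ν) h2 measurableSet_Iic, ← h1,
      ENNReal.ofReal_mul (Real.rpow_nonneg ht'.le _), ofReal_measureReal, mul_comm]
  rw [this]
  have hp1 : ENNReal.ofReal p ≠ 0 := by simpa using hp
  constructor
  · intro h
    by_contra hn
    rw [not_lt, top_le_iff] at hn
    rw [hn, ENNReal.mul_top hp1] at h
    exact lt_irrefl _ h
  · intro h
    exact ENNReal.mul_lt_top ENNReal.ofReal_lt_top h

/-- Theorem 2 of the paper, analytic content: sufficient and necessary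
conditions for `∫_0^∞ z^{p-1} (ν₊(z) + ν₋(z)) dz < ∞`, i.e. for the optimal embedding
to be an `H^p`-embedding. -/
theorem Hp_embedding_conditions
    (s : ℝ → ℝ) (hs : Continuous s) (hmono : StrictMono s) (hs0 : s 0 = 0)
    (ν : Measure ℝ) [IsProbabilityMeasure ν] (hν0 : ν {0} = 0)
    (p : ℝ) (hp : 0 < p) :
    ((∫⁻ y, ENNReal.ofReal (|y| ^ p) ∂ν < ⊤ ∧
        ∫⁻ z in Ici (1 : ℝ), ENNReal.ofReal
          (z ^ (p - 1) * (1 / s z + 1 / |s (-z)|) * |cY s ν z - cY s ν (-z)|) < ⊤) →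
      ∫⁻ z in Ioi (0 : ℝ), ENNReal.ofReal
        (z ^ (p - 1) * (nuPlus s ν z + nuMinus s ν z)) < ⊤) ∧
    ((∫⁻ z in Ioi (0 : ℝ), ENNReal.ofReal
        (z ^ (p - 1) * (nuPlus s ν z + nuMinus s ν z)) < ⊤) →
      ∫⁻ y, ENNReal.ofReal (|y| ^ p) ∂ν < ⊤ ∧
        ∫⁻ z in Ici (1 : ℝ), ENNReal.ofReal
          (z ^ (p - 1) * |cY s ν z - cY s ν (-z)| / (s z + |s (-z)|)) < ⊤) := by
  have key := zeta_key s hs hmono hs0 ν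
  rw [tail_int ν p hp]
  have hmeas : Measurable (fun z : ℝ => ENNReal.ofReal
      (z ^ (p - 1) * (ν.real (Ici z) + ν.real (Iic (-z))))) := by
    have m1 : Antitone (fun z : ℝ => ν.real (Ici z)) := fun a b hab =>
      measureReal_mono (Ici_subset_Ici.2 hab)
    have m2 : Antitone (fun z : ℝ => ν.real (Iic (-z))) := fun a b hab =>
      measureReal_mono (Iic_subset_Iic.2 (neg_le_neg hab))
    exact ((measurable_id.pow_const _).mul (m1.measurable.add m2.measurable)).ennreal_ofReal
  have hsub : Ici (1 : ℝ) ⊆ Ioi 0 := fun x hx => mem_Ioi.2 (lt_of_lt_of_le one_pos (mem_Ici.1 hx))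
  constructor
  · rintro ⟨h1, h2⟩
    have hU : Ioi (0 : ℝ) = Ioo 0 1 ∪ Ici 1 := (Ioo_union_Ici_eq_Ioi one_pos).symm
    rw [hU]
    refine (lintegral_union_le _ _ _).trans_lt (ENNReal.add_lt_top.2 ⟨?_, ?_⟩)
    · have hi : IntegrableOn (fun z : ℝ => z ^ (p - 1) * 4) (Ioo 0 1) :=
        ((intervalIntegral.integrableOn_Ioo_rpow_iff one_pos).2 (by linarith)).mul_const 4
      refine lt_of_le_of_lt ?_ hi.setLIntegral_lt_top
      refine setLIntegral_mono' measurableSet_Ioo fun z hz => ENNReal.ofReal_le_ofReal ?_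
      obtain ⟨-, -, k1, k2, -, -⟩ := key z hz.1
      refine mul_le_mul_of_nonneg_left ?_ (Real.rpow_nonneg hz.1.le _)
      have e1 : (ν (Ici z)).toReal ≤ 1 := measureReal_le_one
      have e2 : (ν (Iic (-z))).toReal ≤ 1 := measureReal_le_one
      rw [nuPlus, nuMinus]
      linarith
    · have h1' := (lintegral_mono_set (μ := volume) hsub).trans_lt h1
      have : ∫⁻ z in Ici (1 : ℝ), ENNReal.ofReal (z ^ (p - 1) * (nuPlus s ν z + nuMinus s ν z)) ≤
          ∫⁻ z in Ici (1 : ℝ), ((ENNReal.ofReal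
            (z ^ (p - 1) * (1 / s z + 1 / |s (-z)|) * |cY s ν z - cY s ν (-z)|)) +
            (2 * ENNReal.ofReal (z ^ (p - 1) * (ν.real (Ici z) + ν.real (Iic (-z)))))) := by
        refine setLIntegral_mono' measurableSet_Ici fun z hz => ?_
        have hz0 : 0 < z := hsub hz
        obtain ⟨-, -, -, -, k, -⟩ := key z hz0
        have hz1 : 0 ≤ z ^ (p - 1) := Real.rpow_nonneg hz0.le _
        have hT : 0 ≤ z ^ (p - 1) * (ν.real (Ici z) + ν.real (Iic (-z))) :=
          mul_nonneg hz1 (add_nonneg measureReal_nonneg measureReal_nonneg)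
        have e2 : (2 : ℝ≥0∞) = ENNReal.ofReal 2 := by simp
        rw [e2, ← ENNReal.ofReal_mul (by norm_num)]
        refine le_trans (ENNReal.ofReal_le_ofReal ?_) ENNReal.ofReal_add_le
        have k' := mul_le_mul_of_nonneg_left k hz1
        rw [nuPlus, nuMinus]
        simp only [Measure.real] at k' ⊢
        nlinarith
      refine this.trans_lt ?_
      rw [lintegral_add_right _ (hmeas.const_mul 2), lintegral_const_mul _ hmeas]
      exact ENNReal.add_lt_top.2 ⟨h2, ENNReal.mul_lt_top (by simp) h1'⟩
  · intro h
    constructor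
    · refine lt_of_le_of_lt ?_ h
      refine setLIntegral_mono' measurableSet_Ioi fun z hz => ENNReal.ofReal_le_ofReal ?_
      have hz0 : 0 < z := hz
      obtain ⟨k1, k2, -, -, -, -⟩ := key z hz0
      refine mul_le_mul_of_nonneg_left ?_ (Real.rpow_nonneg hz0.le _)
      rw [nuPlus, nuMinus]
      simp only [Measure.real]
      linarith
    · refine lt_of_le_of_lt ?_ ((lintegral_mono_set (μ := volume) hsub).trans_lt h)
      refine setLIntegral_mono' measurableSet_Ici fun z hz => ENNReal.ofReal_le_ofReal ?_
      have hz0 : 0 < z := hsub hz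
      obtain ⟨-, -, -, -, -, k⟩ := key z hz0
      rw [mul_div_assoc]
      refine mul_le_mul_of_nonneg_left ?_ (Real.rpow_nonneg hz0.le _)
      have e1 : 0 ≤ (ν (Ici z)).toReal := measureReal_nonneg
      have e2 : 0 ≤ (ν (Iic (-z))).toReal := measureReal_nonneg
      rw [nuPlus, nuMinus]
      linarith
end

section
/- Let p > 0. Suppose in addition that α := sup_{y∈ℝ} s(y) < ∞, that s(y) → -∞ as y → -∞, that ∫_ℝ |s(y)| ν(dy) < ∞, and set m = ∫_ℝ s(y) ν(dy) with m ≥ 0. Then: (a) if m > 0, ∫_0^∞ z^{p-1}(ν₊(z)+ν₋(z)) dz < ∞ holds if and only if ∫_1^∞ z^{p-1}/|s(-z)| dz < ∞ and ∫_ℝ |y|^p ν(dy) < ∞; (b) if m = 0, the condition in (a) is still sufficient, and a necessary and sufficient condition is ∫_1^∞ z^{p-1} |c_Y(z) - c_Y(-z)| / |s(-z)| dz < ∞ together with ∫_ℝ |y|^p ν(dy) < ∞. (This is the analytic content of the paper's Theorem on diffusions transient to +∞: ν₊ and ν₋ are the tail distribution functions of the supremum and of the negative of the infimum of the diffusion stopped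 by the optimal embedding.) -/
open MeasureTheory Set Filter
open scoped ENNReal NNReal Classical

section helpers

variable {s : ℝ → ℝ} {ν : Measure ℝ}

lemma int_min_pos [IsProbabilityMeasure ν] (hs : Continuous s) (hint : Integrable s ν) (a : ℝ)
    (S : Set ℝ) : IntegrableOn (fun w => min a (s w)) S ν :=
  ((integrable_const a).inf hint).integrableOn

lemma int_min_neg [IsProbabilityMeasure ν] (hs : Continuous s) (hint : Integrable s ν) (a : ℝ)
    (S : Set ℝ) : IntegrableOn (fun w => min a |s w|) S ν :=
  ((integrable_const a).inf hint.abs).integrableOn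

lemma cY_pos_nonneg (hmono : StrictMono s) (hs0 : s 0 = 0) {y : ℝ} (hy : 0 ≤ y) :
    0 ≤ cY s ν y := by
  rw [cY, if_pos hy]
  refine setIntegral_nonneg measurableSet_Ici fun w hw => le_min ?_ ?_
  · rw [← hs0]; exact hmono.monotone hy
  · rw [← hs0]; exact hmono.monotone hw

lemma cY_neg_nonneg {y : ℝ} (hy : y < 0) : 0 ≤ cY s ν y := by
  rw [cY, if_neg (not_le.2 hy)]
  exact setIntegral_nonneg measurableSet_Iio fun w hw => le_min (abs_nonneg _) (abs_nonneg _)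

lemma real_le_one [IsProbabilityMeasure ν] (S : Set ℝ) : ν.real S ≤ 1 := measureReal_le_one

lemma cY_pos_le [IsProbabilityMeasure ν] (hs : Continuous s) (hint : Integrable s ν)
    (hmono : StrictMono s) (hs0 : s 0 = 0) {y : ℝ} (hy : 0 ≤ y) :
    cY s ν y ≤ s y := by
  have h0 : 0 ≤ s y := by rw [← hs0]; exact hmono.monotone hy
  rw [cY, if_pos hy]
  calc _ ≤ ∫ w in Ici (0:ℝ), s y ∂ν :=
        setIntegral_mono (int_min_pos hs hint _ _) (integrable_const _).integrableOn
          (fun w => min_le_left _ _)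
    _ = ν.real (Ici 0) * s y := by simp
    _ ≤ 1 * s y := by gcongr; exact measureReal_le_one
    _ = s y := one_mul _

lemma cY_neg_le [IsProbabilityMeasure ν] (hs : Continuous s) (hint : Integrable s ν)
    {y : ℝ} (hy : y < 0) :
    cY s ν y ≤ |s y| := by
  rw [cY, if_neg (not_le.2 hy)]
  calc _ ≤ ∫ w in Iio (0:ℝ), |s y| ∂ν :=
        setIntegral_mono (int_min_neg hs hint _ _) (integrable_const _).integrableOn
          (fun w => min_le_left _ _)
    _ = ν.real (Iio 0) * |s y| := by simp
    _ ≤ 1 * |s y| := by gcongr; exact measureReal_le_one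
    _ = |s y| := one_mul _

lemma cY_neg_leB [IsProbabilityMeasure ν] (hs : Continuous s) (hint : Integrable s ν)
    {y : ℝ} (hy : y < 0) :
    cY s ν y ≤ ∫ w in Iio (0:ℝ), |s w| ∂ν := by
  rw [cY, if_neg (not_le.2 hy)]
  exact setIntegral_mono (int_min_neg hs hint _ _) hint.abs.integrableOn
          (fun w => min_le_right _ _)

lemma cY_pos_leA [IsProbabilityMeasure ν] (hs : Continuous s) (hint : Integrable s ν)
    {y : ℝ} (hy : 0 ≤ y) :
    cY s ν y ≤ ∫ w in Ici (0:ℝ), s w ∂ν := by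
  rw [cY, if_pos hy]
  exact setIntegral_mono (int_min_pos hs hint _ _) hint.integrableOn
          (fun w => min_le_right _ _)

lemma ind_bound [IsProbabilityMeasure ν] (c : ℝ) {y : ℝ} (hc : 0 ≤ c) :
    ∫ w in Ici (0:ℝ), (Ici y).indicator (fun _ => c) w ∂ν ≤ c * ν.real (Ici y) := by
  rw [setIntegral_indicator measurableSet_Ici, setIntegral_const, smul_eq_mul, mul_comm]
  gcongr
  · exact measure_ne_top _ _
  · exact inter_subset_right

lemma A_sub_cY [IsProbabilityMeasure ν] (hs : Continuous s) (hint : Integrable s ν)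
    (hmono : StrictMono s) (hs0 : s 0 = 0) {α : ℝ} (hα : ∀ y, s y ≤ α) {y : ℝ} (hy : 0 ≤ y) :
    (∫ w in Ici (0:ℝ), s w ∂ν) - cY s ν y ≤ α * ν.real (Ici y) := by
  have h0 : 0 ≤ s y := by rw [← hs0]; exact hmono.monotone hy
  have hα0 : 0 ≤ α := hs0 ▸ hα 0
  rw [cY, if_pos hy, ← integral_sub hint.integrableOn (int_min_pos hs hint _ _)]
  refine le_trans ?_ (ind_bound α hα0)
  refine setIntegral_mono (hint.integrableOn.sub (int_min_pos hs hint _ _))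
    ((integrable_const _).indicator measurableSet_Ici).integrableOn fun w => ?_
  by_cases hw : w ∈ Ici y
  · have h1 : s y ≤ s w := hmono.monotone hw
    simp only [indicator_of_mem hw, min_eq_left h1]
    linarith [hα w]
  · have h1 : s w ≤ s y := hmono.monotone (not_le.1 hw).le
    simp only [indicator_of_notMem hw, min_eq_right h1]
    linarith

lemma cY_sub [IsProbabilityMeasure ν] (hs : Continuous s) (hint : Integrable s ν)
    (hmono : StrictMono s) {x y : ℝ} (hx : 0 ≤ x) (hxy : x ≤ y) :
    cY s ν y - cY s ν x ≤ (s y - s x) * ν.real (Ici x) := by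
  have h0 : s x ≤ s y := hmono.monotone hxy
  rw [cY, if_pos (hx.trans hxy), cY, if_pos hx,
    ← integral_sub (int_min_pos hs hint _ _) (int_min_pos hs hint _ _)]
  refine le_trans ?_ (ind_bound (s y - s x) (by linarith))
  refine setIntegral_mono ((int_min_pos hs hint _ _).sub (int_min_pos hs hint _ _))
    ((integrable_const _).indicator measurableSet_Ici).integrableOn fun w => ?_
  by_cases hw : w ∈ Ici x
  · have h1 : s x ≤ s w := hmono.monotone hw
    simp only [indicator_of_mem hw, min_eq_left h1]
    linarith [min_le_left (s y) (s w)]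
  · have h1 : s w ≤ s x := hmono.monotone (not_le.1 hw).le
    simp only [indicator_of_notMem hw, min_eq_right h1, min_eq_right (h1.trans h0)]
    linarith

lemma cY_mono [IsProbabilityMeasure ν] (hs : Continuous s) (hint : Integrable s ν)
    (hmono : StrictMono s) {x y : ℝ} (hx : 0 ≤ x) (hxy : x ≤ y) :
    cY s ν x ≤ cY s ν y := by
  have h0 : s x ≤ s y := hmono.monotone hxy
  rw [cY, if_pos hx, cY, if_pos (hx.trans hxy)]
  exact setIntegral_mono (int_min_pos hs hint _ _) (int_min_pos hs hint _ _)
    fun w => min_le_min_right _ h0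

lemma cY_cont [IsProbabilityMeasure ν] (hs : Continuous s) (hint : Integrable s ν)
    (hmono : StrictMono s) : ContinuousOn (cY s ν) (Ici 0) := by
  have key : ∀ x y, 0 ≤ x → x ≤ y → |cY s ν y - cY s ν x| ≤ |s y - s x| := by
    intro x y hx hxy
    have h0 : s x ≤ s y := hmono.monotone hxy
    rw [abs_of_nonneg (sub_nonneg.2 (cY_mono hs hint hmono hx hxy)),
      abs_of_nonneg (sub_nonneg.2 h0)]
    refine (cY_sub hs hint hmono hx hxy).trans ?_
    exact mul_le_of_le_one_right (by linarith) measureReal_le_one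
  have key2 : ∀ x y, 0 ≤ x → 0 ≤ y → |cY s ν y - cY s ν x| ≤ |s y - s x| := by
    intro x y hx hy
    rcases le_total x y with h | h
    · exact key x y hx h
    · rw [abs_sub_comm, abs_sub_comm (s y)]; exact key y x hy h
  intro x hx
  rw [ContinuousWithinAt, tendsto_iff_norm_sub_tendsto_zero]
  have h1 : Tendsto (fun y => |s y - s x|) (nhdsWithin x (Ici 0)) (nhds 0) := by
    have : Tendsto (fun y => |s y - s x|) (nhds x) (nhds |s x - s x|) :=
      ((hs.sub continuous_const).abs).tendsto x
    simp only [sub_self, abs_zero] at this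
    exact this.mono_left nhdsWithin_le_nhds
  refine tendsto_of_tendsto_of_tendsto_of_le_of_le' tendsto_const_nhds h1
    (Eventually.of_forall fun _ => norm_nonneg _) ?_
  filter_upwards [self_mem_nhdsWithin] with y hy
  exact key2 x y hx hy

lemma tail_tendsto [IsProbabilityMeasure ν] :
    Tendsto (fun y => ν.real (Ici y)) atTop (nhds 0) := by
  have h := tendsto_measure_iInter_atTop (μ := ν) (s := fun y : ℝ => Ici y)
    (fun i => measurableSet_Ici.nullMeasurableSet) (fun a b h => Ici_subset_Ici.2 h)
    ⟨0, measure_ne_top _ _⟩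
  have h2 : (⋂ n : ℝ, Ici n) = ∅ := by
    ext x; simp only [mem_iInter, mem_Ici, mem_empty_iff_false, iff_false, not_forall, not_le]
    exact ⟨x + 1, by linarith⟩
  rw [h2, measure_empty] at h
  exact (ENNReal.tendsto_toReal ENNReal.zero_ne_top).comp h

lemma cY_tendsto [IsProbabilityMeasure ν] (hs : Continuous s) (hint : Integrable s ν)
    (hmono : StrictMono s) (hs0 : s 0 = 0) {α : ℝ} (hα : ∀ y, s y ≤ α) :
    Tendsto (cY s ν) atTop (nhds (∫ w in Ici (0:ℝ), s w ∂ν)) := by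
  have h1 : Tendsto (fun y => (∫ w in Ici (0:ℝ), s w ∂ν) - α * ν.real (Ici y)) atTop
      (nhds (∫ w in Ici (0:ℝ), s w ∂ν)) := by
    simpa using tendsto_const_nhds.sub ((tail_tendsto (ν := ν)).const_mul α)
  refine tendsto_of_tendsto_of_tendsto_of_le_of_le' h1 tendsto_const_nhds ?_ ?_
  · filter_upwards [eventually_ge_atTop 0] with y hy
    linarith [A_sub_cY (ν := ν) hs hint hmono hs0 hα hy]
  · filter_upwards [eventually_ge_atTop 0] with y hy
    exact cY_pos_leA hs hint hy

/-- when attained, the value -/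
lemma zetaMinus_eq {z y : ℝ} (h : y ∈ argYMinus s ν z) :
    zetaMinus s ν z = slopeYMinus s ν z y := by
  rw [zetaMinus, if_pos ⟨y, h⟩]
  refine IsGreatest.csSup_eq ⟨⟨y, h.1, rfl⟩, ?_⟩
  rintro _ ⟨x, hx, rfl⟩
  exact h.2 x hx

lemma zetaPlus_eq {z y : ℝ} (h : y ∈ argYPlus s ν z) :
    zetaPlus s ν z = - slopeYPlus s ν z y := by
  rw [zetaPlus, if_pos ⟨y, h⟩]
  congr 1
  refine IsLeast.csInf_eq ⟨⟨y, h.1, rfl⟩, ?_⟩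
  rintro _ ⟨x, hx, rfl⟩
  exact h.2 x hx

lemma s_pos (hmono : StrictMono s) (hs0 : s 0 = 0) {y : ℝ} (hy : 0 < y) : 0 < s y := by
  rw [← hs0]; exact hmono hy

lemma s_neg (hmono : StrictMono s) (hs0 : s 0 = 0) {y : ℝ} (hy : 0 < y) : s (-y) < 0 := by
  rw [← hs0]; exact hmono (by linarith)

lemma zetaPlus_nonneg [IsProbabilityMeasure ν] (hmono : StrictMono s) (hs0 : s 0 = 0)
    (htend : Tendsto s atBot atBot) {z : ℝ} (hz : 0 < z) : 0 ≤ zetaPlus s ν z := by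
  by_cases h : (argYPlus s ν z).Nonempty
  · obtain ⟨y, hy⟩ := h
    rw [zetaPlus_eq hy]
    by_contra hneg
    have hg : 0 < slopeYPlus s ν z y := by linarith
    set g := slopeYPlus s ν z y
    have h1 : Tendsto (fun x : ℝ => s (-x)) atTop atBot := htend.comp tendsto_neg_atTop_atBot
    obtain ⟨x, hx, hx0⟩ := ((h1.eventually (eventually_lt_atBot (-(cY s ν z / g)))).and
      (eventually_gt_atTop 0)).exists
    have h2 := hy.2 x hx0
    have h3 := s_neg hmono hs0 hx0
    have h4 := s_pos hmono hs0 hz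
    have h5 : 0 ≤ cY s ν (-x) := cY_neg_nonneg (by linarith)
    rw [slopeYPlus, slopeYPlus, le_div_iff₀ (by linarith)] at h2
    change g * _ ≤ _ at h2
    have h6 : cY s ν z / g < - s (-x) := by linarith
    rw [div_lt_iff₀ hg] at h6
    nlinarith
  · rw [zetaPlus, if_neg h]

lemma zetaPlus_le_one [IsProbabilityMeasure ν] (hs : Continuous s) (hint : Integrable s ν)
    (hmono : StrictMono s) (hs0 : s 0 = 0) {z : ℝ} (hz : 0 < z) : zetaPlus s ν z ≤ 1 := by
  by_cases h : (argYPlus s ν z).Nonempty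
  · obtain ⟨y, hy⟩ := h
    rw [zetaPlus_eq hy, slopeYPlus, ← neg_div]
    have h3 := s_neg hmono hs0 hy.1
    have h4 := s_pos hmono hs0 hz
    have h5 : cY s ν (-y) ≤ |s (-y)| := cY_neg_le hs hint (by linarith [hy.1])
    have h6 : 0 ≤ cY s ν z := cY_pos_nonneg hmono hs0 hz.le
    rw [abs_of_neg h3] at h5
    rw [div_le_one (by linarith)]
    linarith
  · rw [zetaPlus, if_neg h]; norm_num

lemma zetaPlus_le [IsProbabilityMeasure ν] (hs : Continuous s) (hint : Integrable s ν)
    (hmono : StrictMono s) (hs0 : s 0 = 0) {α : ℝ} (hα : ∀ y, s y ≤ α)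
    (hAB : ∫ w in Iio (0:ℝ), |s w| ∂ν ≤ ∫ w in Ici (0:ℝ), s w ∂ν)
    {z : ℝ} (hz : 1 ≤ z) : zetaPlus s ν z ≤ α / s 1 * ν.real (Ici z) := by
  have hz0 : 0 < z := by linarith
  have hα0 : 0 ≤ α := hs0 ▸ hα 0
  have h1 := s_pos hmono hs0 one_pos
  have h1z : s 1 ≤ s z := hmono.monotone hz
  by_cases h : (argYPlus s ν z).Nonempty
  · obtain ⟨y, hy⟩ := h
    rw [zetaPlus_eq hy, slopeYPlus, ← neg_div]
    have h3 := s_neg hmono hs0 hy.1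
    have h5 := cY_neg_leB (ν := ν) hs hint (y := -y) (by linarith [hy.1])
    have h6 := A_sub_cY (ν := ν) hs hint hmono hs0 hα hz0.le
    rw [div_mul_eq_mul_div]
    apply div_le_div₀ (by positivity) (by linarith) h1 (by linarith)
  · rw [zetaPlus, if_neg h]; positivity

lemma zetaMinus_le_one [IsProbabilityMeasure ν] (hs : Continuous s) (hint : Integrable s ν)
    (hmono : StrictMono s) (hs0 : s 0 = 0) {z : ℝ} (hz : 0 < z) : zetaMinus s ν z ≤ 1 := by
  by_cases h : (argYMinus s ν z).Nonempty
  · obtain ⟨y, hy⟩ := h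
    rw [zetaMinus_eq hy, slopeYMinus]
    have h3 := s_neg hmono hs0 hz
    have h4 := s_pos hmono hs0 hy.1
    have h5 : 0 ≤ cY s ν (-z) := cY_neg_nonneg (by linarith)
    have h6 := cY_pos_le (ν := ν) hs hint hmono hs0 hy.1.le
    rw [div_le_one (by linarith)]
    linarith
  · rw [zetaMinus, if_neg h]; norm_num

lemma zetaMinus_le [IsProbabilityMeasure ν] (hs : Continuous s) (hint : Integrable s ν)
    (hmono : StrictMono s) (hs0 : s 0 = 0)
    (hAB : ∫ w in Iio (0:ℝ), |s w| ∂ν ≤ ∫ w in Ici (0:ℝ), s w ∂ν)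
    {z : ℝ} (hz : 0 < z) :
    zetaMinus s ν z ≤ ((∫ w in Ici (0:ℝ), s w ∂ν) - cY s ν (-z)) / |s (-z)| := by
  have h3 := s_neg hmono hs0 hz
  have h5 := cY_neg_leB (ν := ν) hs hint (y := -z) (by linarith)
  rw [abs_of_neg h3]
  by_cases h : (argYMinus s ν z).Nonempty
  · obtain ⟨y, hy⟩ := h
    rw [zetaMinus_eq hy, slopeYMinus]
    have h4 := s_pos hmono hs0 hy.1
    have h6 := cY_pos_leA (ν := ν) hs hint hy.1.le
    apply div_le_div₀ <;> linarith
  · rw [zetaMinus, if_neg h]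
    apply div_nonneg <;> linarith

lemma argYMinus_nonempty [IsProbabilityMeasure ν] (hs : Continuous s) (hint : Integrable s ν)
    (hmono : StrictMono s) (hs0 : s 0 = 0) {α : ℝ} (hα : ∀ y, s y ≤ α)
    {z : ℝ} (hz : 0 < z) (hD : cY s ν (-z) < ∫ w in Ici (0:ℝ), s w ∂ν) :
    (argYMinus s ν z).Nonempty := by
  set A := ∫ w in Ici (0:ℝ), s w ∂ν with hA
  have hα0 : 0 ≤ α := hs0 ▸ hα 0
  have h3 := s_neg hmono hs0 hz
  have hcz : 0 ≤ cY s ν (-z) := cY_neg_nonneg (by linarith)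
  set D := A - cY s ν (-z) with hDdef
  have hD0 : 0 < D := by linarith
  have e1 := (cY_tendsto (ν := ν) hs hint hmono hs0 hα).eventually
    (lt_mem_nhds (show A - D / 2 < A by linarith))
  have e2 := (tail_tendsto (ν := ν)).eventually
    (gt_mem_nhds (show 0 < D / 2 / (α - s (-z)) by apply div_pos <;> linarith))
  obtain ⟨Y, ⟨hY1, hY2⟩, hY0⟩ := ((e1.and e2).and (eventually_gt_atTop 0)).exists
  have hden : ∀ y, 0 ≤ y → 0 < s y - s (-z) := by
    intro y hy
    have : s 0 ≤ s y := hmono.monotone hy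
    linarith
  have hcont : ContinuousOn (slopeYMinus s ν z) (Icc 0 Y) := by
    unfold slopeYMinus
    refine ContinuousOn.div ?_ ?_ ?_
    · exact ((cY_cont hs hint hmono).mono Icc_subset_Ici_self).sub continuousOn_const
    · exact (hs.sub continuous_const).continuousOn
    · intro y hy; exact (hden y hy.1).ne'
  have hYpos : D / 2 / (α - s (-z)) ≤ slopeYMinus s ν z Y := by
    unfold slopeYMinus
    have := hden Y hY0.le
    apply div_le_div₀ <;> linarith [hα Y]
  have hYpos' : 0 < slopeYMinus s ν z Y :=
    lt_of_lt_of_le (by apply div_pos <;> linarith) hYpos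
  have htail : ∀ y, Y ≤ y → slopeYMinus s ν z y ≤ slopeYMinus s ν z Y := by
    intro y hy
    have hd := hden y (hY0.le.trans hy)
    have hdY := hden Y hY0.le
    have hc := cY_sub (ν := ν) hs hint hmono hY0.le hy
    have hsY : s Y ≤ s y := hmono.monotone hy
    have h7 : (s y - s Y) * ν.real (Ici Y) ≤ (s y - s Y) * slopeYMinus s ν z Y := by
      apply mul_le_mul_of_nonneg_left <;> linarith
    have h8 : slopeYMinus s ν z Y * (s Y - s (-z)) = cY s ν Y - cY s ν (-z) := by
      unfold slopeYMinus; field_simp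
    rw [slopeYMinus, div_le_iff₀ hd]
    nlinarith
  obtain ⟨y, hy, hmax⟩ := isCompact_Icc.exists_isMaxOn ⟨0, by simp [hY0.le]⟩ hcont
  have hyY := hmax (show Y ∈ Icc 0 Y from ⟨hY0.le, le_rfl⟩)
  refine ⟨y, ?_, ?_⟩
  · rcases hy.1.eq_or_lt with h | h
    · exfalso
      have h9 : slopeYMinus s ν z Y ≤ slopeYMinus s ν z y := hyY
      have h10 : slopeYMinus s ν z y ≤ 0 := by
        rw [← h, slopeYMinus]
        have h11 := cY_pos_le (ν := ν) hs hint hmono hs0 (le_refl 0)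
        apply div_nonpos_of_nonpos_of_nonneg <;> linarith
      linarith
    · exact h
  · intro x hx
    rcases le_total x Y with h | h
    · exact hmax (show x ∈ Icc 0 Y from ⟨hx.le, h⟩)
    · exact (htail x h).trans hyY

lemma zetaMinus_ge [IsProbabilityMeasure ν] (hs : Continuous s) (hint : Integrable s ν)
    (hmono : StrictMono s) (hs0 : s 0 = 0) {α : ℝ} (hα : ∀ y, s y ≤ α)
    (hαl : Tendsto s atTop (nhds α))
    (hAB : ∫ w in Iio (0:ℝ), |s w| ∂ν ≤ ∫ w in Ici (0:ℝ), s w ∂ν)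
    {z : ℝ} (hz : 0 < z) :
    ((∫ w in Ici (0:ℝ), s w ∂ν) - cY s ν (-z)) / (α + |s (-z)|) ≤ zetaMinus s ν z := by
  have hα0 : 0 ≤ α := hs0 ▸ hα 0
  have h3 := s_neg hmono hs0 hz
  have h5 := cY_neg_leB (ν := ν) hs hint (y := -z) (by linarith)
  rw [abs_of_neg h3]
  by_cases h : (argYMinus s ν z).Nonempty
  · obtain ⟨y, hy⟩ := h
    rw [zetaMinus_eq hy, div_le_iff₀ (by linarith)]
    have l1 := (cY_tendsto (ν := ν) hs hint hmono hs0 hα).sub_const (cY s ν (-z))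
    have l2 := (hαl.add_const (-s (-z))).const_mul (slopeYMinus s ν z y)
    refine le_of_tendsto_of_tendsto l1 l2 ?_
    filter_upwards [eventually_gt_atTop 0] with x hx
    have h4 := s_pos hmono hs0 hx
    have := hy.2 x hx
    rw [slopeYMinus, div_le_iff₀ (by linarith)] at this
    linarith
  · have : ¬ cY s ν (-z) < ∫ w in Ici (0:ℝ), s w ∂ν := fun h' =>
      h (argYMinus_nonempty hs hint hmono hs0 hα hz h')
    rw [zetaMinus, if_neg h]
    apply div_nonpos_of_nonpos_of_nonneg <;> linarith

lemma fin_of_le {S : Set ℝ} (hS : MeasurableSet S) {f g h : ℝ → ℝ} {K : ℝ} (hK : 0 ≤ K)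
    (hg : Measurable g)
    (hle : ∀ z ∈ S, f z ≤ K * (g z + h z))
    (h1 : ∫⁻ z in S, ENNReal.ofReal (g z) < ⊤) (h2 : ∫⁻ z in S, ENNReal.ofReal (h z) < ⊤) :
    ∫⁻ z in S, ENNReal.ofReal (f z) < ⊤ := by
  calc ∫⁻ z in S, ENNReal.ofReal (f z)
      ≤ ∫⁻ z in S, ENNReal.ofReal K * (ENNReal.ofReal (g z) + ENNReal.ofReal (h z)) := by
        refine setLIntegral_mono' hS fun z hz => ?_
        refine (ENNReal.ofReal_le_ofReal (hle z hz)).trans ?_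
        rw [ENNReal.ofReal_mul hK]
        gcongr
        exact ENNReal.ofReal_add_le
    _ = ENNReal.ofReal K * ((∫⁻ z in S, ENNReal.ofReal (g z)) +
          ∫⁻ z in S, ENNReal.ofReal (h z)) := by
        rw [lintegral_const_mul' _ _ ENNReal.ofReal_ne_top, lintegral_add_left hg.ennreal_ofReal]
    _ < ⊤ := ENNReal.mul_lt_top ENNReal.ofReal_lt_top (ENNReal.add_lt_top.2 ⟨h1, h2⟩)

lemma fin_of_le' {S : Set ℝ} (hS : MeasurableSet S) {f h : ℝ → ℝ} {K : ℝ} (hK : 0 ≤ K)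
    (hle : ∀ z ∈ S, f z ≤ K * h z)
    (h2 : ∫⁻ z in S, ENNReal.ofReal (h z) < ⊤) :
    ∫⁻ z in S, ENNReal.ofReal (f z) < ⊤ :=
  fin_of_le hS (g := fun _ => 0) hK measurable_const (by simpa using hle) (by simp) h2

/-- two-sided tail -/
noncomputable def tau (ν : Measure ℝ) (z : ℝ) : ℝ := ν.real (Ici z) + ν.real (Iic (-z))

lemma tau_meas [IsProbabilityMeasure ν] : Measurable (tau ν) := by
  refine Antitone.measurable fun a b h => ?_
  unfold tau
  gcongr
  · exact measure_ne_top _ _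
  · exact measure_ne_top _ _

lemma tau_nonneg (z : ℝ) : 0 ≤ tau ν z := by unfold tau; positivity

lemma moment_iff [IsProbabilityMeasure ν] {p : ℝ} (hp : 0 < p) :
    ∫⁻ y, ENNReal.ofReal (|y| ^ p) ∂ν < ⊤ ↔
      ∫⁻ z in Ioi (0:ℝ), ENNReal.ofReal (z ^ (p - 1) * tau ν z) < ⊤ := by
  rw [lintegral_rpow_eq_lintegral_meas_le_mul ν (Eventually.of_forall fun y => abs_nonneg y)
    (by fun_prop) hp]
  have : ∫⁻ t in Ioi (0:ℝ), ν {a : ℝ | t ≤ |a|} * ENNReal.ofReal (t ^ (p - 1)) =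
      ∫⁻ z in Ioi (0:ℝ), ENNReal.ofReal (z ^ (p - 1) * tau ν z) := by
    refine setLIntegral_congr_fun measurableSet_Ioi fun t ht => ?_
    have ht : 0 < t := ht
    have e : {a : ℝ | t ≤ |a|} = Ici t ∪ Iic (-t) := by
      ext a; simp only [Set.mem_ofPred_eq, mem_union, mem_Ici, mem_Iic, le_abs]
      constructor <;> rintro (h | h) <;> first | (left; linarith) | (right; linarith)
    have hd : Disjoint (Ici t) (Iic (-t)) := by
      rw [Set.disjoint_left]; intro a ha hb
      simp only [mem_Ici, mem_Iic] at ha hb; linarith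
    rw [e, measure_union hd measurableSet_Iic, ENNReal.ofReal_mul (by positivity), mul_comm, tau,
      ENNReal.ofReal_add (by positivity) (by positivity), ofReal_measureReal, ofReal_measureReal]
  rw [this]
  have hp' : ENNReal.ofReal p ≠ 0 := by simpa using hp
  constructor
  · intro h
    by_contra h'
    rw [not_lt, top_le_iff] at h'
    rw [h', ENNReal.mul_top hp'] at h
    exact lt_irrefl _ h
  · intro h; exact ENNReal.mul_lt_top ENNReal.ofReal_lt_top h

lemma core [IsProbabilityMeasure ν] (hs : Continuous s) (hint : Integrable s ν)
    (hmono : StrictMono s) (hs0 : s 0 = 0) {α : ℝ} (hα : ∀ y, s y ≤ α)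
    (hαl : Tendsto s atTop (nhds α)) (htend : Tendsto s atBot atBot)
    (hAB : ∫ w in Iio (0:ℝ), |s w| ∂ν ≤ ∫ w in Ici (0:ℝ), s w ∂ν) {p : ℝ} (hp : 0 < p) :
    (∫⁻ z in Ioi (0 : ℝ), ENNReal.ofReal
          (z ^ (p - 1) * (nuPlus s ν z + nuMinus s ν z)) < ⊤) ↔
     (∫⁻ z in Ici (1 : ℝ), ENNReal.ofReal
        (z ^ (p - 1) * ((∫ w in Ici (0:ℝ), s w ∂ν) - cY s ν (-z)) / |s (-z)|) < ⊤ ∧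
      ∫⁻ z in Ioi (0:ℝ), ENNReal.ofReal (z ^ (p - 1) * tau ν z) < ⊤) := by
  set A := ∫ w in Ici (0:ℝ), s w ∂ν with hA
  have hα0 : 0 ≤ α := hs0 ▸ hα 0
  have hT1 : 0 < -s (-1) := by linarith [s_neg hmono hs0 one_pos]
  have hsum : ∀ z, nuPlus s ν z + nuMinus s ν z = tau ν z + zetaPlus s ν z + zetaMinus s ν z := by
    intro z; simp only [nuPlus, nuMinus, tau, Measure.real]; ring
  have hDn : ∀ z, 0 < z → 0 ≤ A - cY s ν (-z) := fun z hz => by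
    linarith [cY_neg_leB (ν := ν) hs hint (y := -z) (by linarith)]
  have hzm : ∀ z, 0 < z → 0 ≤ zetaMinus s ν z := fun z hz =>
    le_trans (div_nonneg (hDn z hz) (by positivity))
      (zetaMinus_ge hs hint hmono hs0 hα hαl hAB hz)
  have hzp : ∀ z, 0 < z → 0 ≤ zetaPlus s ν z := fun z hz =>
    zetaPlus_nonneg hmono hs0 htend hz
  have hsub : Ici (1:ℝ) ⊆ Ioi 0 := fun z hz => mem_Ioi.2 (lt_of_lt_of_le one_pos (mem_Ici.1 hz))
  constructor
  · intro hI
    constructor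
    · refine fin_of_le' measurableSet_Ici (K := (α + -s (-1)) / (-s (-1)))
        (div_nonneg (by linarith) hT1.le) ?_ ((lintegral_mono_set hsub).trans_lt hI)
      intro z hz
      have hz1 : 1 ≤ z := hz
      have hz0 : 0 < z := hsub hz
      have h3 := s_neg hmono hs0 hz0
      have hT : s (-z) ≤ s (-1) := hmono.monotone (by linarith)
      have h4 := zetaMinus_ge (ν := ν) hs hint hmono hs0 hα hαl hAB hz0
      rw [← hA, abs_of_neg h3, div_le_iff₀ (by linarith)] at h4
      have h5 : (A - cY s ν (-z)) / |s (-z)| ≤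
          (α + -s (-1)) / (-s (-1)) * zetaMinus s ν z := by
        rw [abs_of_neg h3, div_le_iff₀ (by linarith), div_mul_eq_mul_div, div_mul_eq_mul_div,
          le_div_iff₀ hT1]
        have h6 := hzm z hz0
        have h7 : zetaMinus s ν z * (α + -s (-z)) * (-s (-1)) ≤
            (α + -s (-1)) * zetaMinus s ν z * -s (-z) := by
          have : 0 ≤ zetaMinus s ν z * (α * (s (-1) - s (-z))) :=
            mul_nonneg h6 (mul_nonneg hα0 (by linarith))
          nlinarith
        exact (mul_le_mul_of_nonneg_right h4 hT1.le).trans h7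
      have hK : 0 ≤ (α + -s (-1)) / (-s (-1)) := div_nonneg (by linarith) hT1.le
      have h8 : zetaMinus s ν z ≤ nuPlus s ν z + nuMinus s ν z := by
        rw [hsum]; linarith [hzp z hz0, tau_nonneg (ν := ν) z]
      rw [mul_div_assoc, mul_left_comm]
      refine mul_le_mul_of_nonneg_left (h5.trans ?_) (by positivity)
      exact mul_le_mul_of_nonneg_left h8 hK
    · refine fin_of_le' measurableSet_Ioi (K := 1) zero_le_one ?_ hI
      intro z hz
      rw [one_mul]
      have hz0 : 0 < z := hz
      refine mul_le_mul_of_nonneg_left ?_ (by positivity)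
      rw [hsum]; linarith [hzp z hz0, hzm z hz0]
  · rintro ⟨hJ, hL⟩
    have hU : Ioi (0:ℝ) ⊆ Ioo 0 1 ∪ Ici 1 := by
      intro z hz
      rcases lt_or_ge z 1 with h | h
      · exact Or.inl ⟨hz, h⟩
      · exact Or.inr h
    refine (lintegral_mono_set hU).trans_lt ((lintegral_union_le _ _ _).trans_lt ?_)
    rw [ENNReal.add_lt_top]
    constructor
    · refine fin_of_le' measurableSet_Ioo (K := 4) (h := fun z => z ^ (p - 1)) (by norm_num) ?_ ?_
      · intro z hz
        rw [mul_comm]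
        refine mul_le_mul_of_nonneg_right ?_ (Real.rpow_nonneg hz.1.le _)
        rw [hsum, tau]
        linarith [zetaPlus_le_one (ν := ν) hs hint hmono hs0 hz.1,
          zetaMinus_le_one (ν := ν) hs hint hmono hs0 hz.1,
          real_le_one (ν := ν) (Ici z), real_le_one (ν := ν) (Iic (-z))]
      · have h := (intervalIntegral.intervalIntegrable_rpow' (a := 0) (b := 1)
          (show -1 < p - 1 by linarith))
        rw [intervalIntegrable_iff_integrableOn_Ioo_of_le zero_le_one] at h
        exact h.lintegral_lt_top
    · have hK : 0 ≤ α / s 1 := div_nonneg hα0 (s_pos hmono hs0 one_pos).le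
      refine fin_of_le measurableSet_Ici (K := 1 + α / s 1) (by linarith)
        (g := fun z => z ^ (p - 1) * tau ν z) ?_ ?_ ((lintegral_mono_set hsub).trans_lt hL) hJ
      · exact (measurable_id.pow_const _).mul tau_meas
      · intro z hz
        have hz0 : 0 < z := hsub hz
        have h1 := zetaPlus_le (ν := ν) hs hint hmono hs0 hα hAB hz
        have h2 := zetaMinus_le (ν := ν) hs hint hmono hs0 hAB hz0
        rw [← hA] at h2
        rw [mul_div_assoc, ← mul_add, mul_left_comm]
        refine mul_le_mul_of_nonneg_left ?_ (by positivity)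
        rw [hsum]
        have h3 : α / s 1 * ν.real (Ici z) ≤ α / s 1 * tau ν z :=
          mul_le_mul_of_nonneg_left (by unfold tau; linarith [measureReal_nonneg (μ := ν) (s := Iic (-z))]) hK
        have h4 : 0 ≤ (A - cY s ν (-z)) / |s (-z)| := div_nonneg (hDn z hz0) (abs_nonneg _)
        nlinarith [mul_nonneg hK h4]

end helpers

/-- Theorem 3 of the paper, analytic content: the case of a diffusion
transient to `+∞`, i.e. `sup s < ∞` and `s(y) → -∞` as `y → -∞`, with `s` `ν`-integrable
and `m = ∫ s dν ≥ 0`.  (a) if `m > 0`, the embedding is `H^p` iff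
`∫_1^∞ z^{p-1}/|s(-z)| dz < ∞` and `ν` has finite `p`-th moment; (b) if `m = 0`, that
condition is still sufficient, and a necessary and sufficient condition is
`∫_1^∞ z^{p-1} |c_Y(z)-c_Y(-z)|/|s(-z)| dz < ∞` plus finite `p`-th moment. -/
theorem Hp_embedding_transient_case
    (s : ℝ → ℝ) (hs : Continuous s) (hmono : StrictMono s) (hs0 : s 0 = 0)
    (ν : Measure ℝ) [IsProbabilityMeasure ν] (hν0 : ν {0} = 0)
    (p : ℝ) (hp : 0 < p)
    (hbdd : BddAbove (Set.range s))
    (htend : Tendsto s atBot atBot)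
    (hint : Integrable s ν)
    (hm : 0 ≤ ∫ y, s y ∂ν) :
    ((0 < ∫ y, s y ∂ν) →
      ((∫⁻ z in Ioi (0 : ℝ), ENNReal.ofReal
          (z ^ (p - 1) * (nuPlus s ν z + nuMinus s ν z)) < ⊤) ↔
        (∫⁻ z in Ici (1 : ℝ), ENNReal.ofReal (z ^ (p - 1) / |s (-z)|) < ⊤ ∧
          ∫⁻ y, ENNReal.ofReal (|y| ^ p) ∂ν < ⊤))) ∧
    ((∫ y, s y ∂ν = 0) →
      ((∫⁻ z in Ici (1 : ℝ), ENNReal.ofReal (z ^ (p - 1) / |s (-z)|) < ⊤ ∧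
          ∫⁻ y, ENNReal.ofReal (|y| ^ p) ∂ν < ⊤) →
        ∫⁻ z in Ioi (0 : ℝ), ENNReal.ofReal
          (z ^ (p - 1) * (nuPlus s ν z + nuMinus s ν z)) < ⊤) ∧
      ((∫⁻ z in Ioi (0 : ℝ), ENNReal.ofReal
          (z ^ (p - 1) * (nuPlus s ν z + nuMinus s ν z)) < ⊤) ↔
        (∫⁻ z in Ici (1 : ℝ), ENNReal.ofReal
            (z ^ (p - 1) * |cY s ν z - cY s ν (-z)| / |s (-z)|) < ⊤ ∧
          ∫⁻ y, ENNReal.ofReal (|y| ^ p) ∂ν < ⊤))) := by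
  set A := ∫ w in Ici (0:ℝ), s w ∂ν with hA
  set B := ∫ w in Iio (0:ℝ), |s w| ∂ν with hB
  have hsplit : ∫ y, s y ∂ν = A - B := by
    have h1 := integral_add_compl (μ := ν) (f := s) (measurableSet_Ici (a := (0:ℝ))) hint
    have h2 : ∫ w in Iio (0:ℝ), |s w| ∂ν = - ∫ w in Iio (0:ℝ), s w ∂ν := by
      rw [← integral_neg]
      refine setIntegral_congr_fun measurableSet_Iio fun w hw => ?_
      have : s w < s 0 := hmono hw
      exact abs_of_neg (by linarith)
    rw [compl_Ici] at h1
    rw [hA, hB, h2, ← h1]; ring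
  have hAB : B ≤ A := by linarith
  set α := ⨆ y, s y with hαdef
  have hα : ∀ y, s y ≤ α := fun y => le_ciSup hbdd y
  have hαl : Tendsto s atTop (nhds α) := tendsto_atTop_ciSup hmono.monotone hbdd
  have hα0 : 0 ≤ α := hs0 ▸ hα 0
  have hcore := core (ν := ν) hs hint hmono hs0 hα hαl htend hAB hp
  rw [← hA] at hcore
  rw [moment_iff hp]
  have hT1 : 0 < -s (-1) := by linarith [s_neg hmono hs0 one_pos]
  have hDA : ∀ z, 1 ≤ z → A - cY s ν (-z) ≤ A := fun z hz => by
    linarith [cY_neg_nonneg (s := s) (ν := ν) (y := -z) (by linarith)]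
  have hA0 : 0 ≤ A := by
    have := cY_neg_nonneg (s := s) (ν := ν) (y := -1) (by norm_num)
    linarith [cY_neg_leB (ν := ν) hs hint (y := -1) (by norm_num)]
  have hsub : Ici (1:ℝ) ⊆ Ioi 0 := fun z hz => mem_Ioi.2 (lt_of_lt_of_le one_pos (mem_Ici.1 hz))
  have hsuff : ∫⁻ z in Ici (1 : ℝ), ENNReal.ofReal (z ^ (p - 1) / |s (-z)|) < ⊤ →
      ∫⁻ z in Ici (1 : ℝ), ENNReal.ofReal
        (z ^ (p - 1) * (A - cY s ν (-z)) / |s (-z)|) < ⊤ := by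
    refine fin_of_le' measurableSet_Ici hA0 fun z hz => ?_
    have hz0 : 0 < z := hsub hz
    rw [mul_comm, mul_div_assoc]
    exact mul_le_mul_of_nonneg_right (hDA z hz) (by positivity)
  constructor
  · intro hm0
    rw [hcore]
    refine and_congr_left fun _ => ⟨?_, hsuff⟩
    have hm1 : 0 < A - B := by linarith
    refine fin_of_le' measurableSet_Ici (K := (A - B)⁻¹) (by positivity) fun z hz => ?_
    have hz0 : 0 < z := hsub hz
    have h5 := cY_neg_leB (ν := ν) hs hint (y := -z) (by linarith)
    rw [← hB] at h5
    have h6 : 1 ≤ (A - B)⁻¹ * (A - cY s ν (-z)) := by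
      rw [inv_mul_eq_div, le_div_iff₀ hm1]; linarith
    have h7 : 0 ≤ z ^ (p - 1) / |s (-z)| := by positivity
    calc z ^ (p - 1) / |s (-z)| ≤ z ^ (p - 1) / |s (-z)| * ((A - B)⁻¹ * (A - cY s ν (-z))) :=
          le_mul_of_one_le_right h7 h6
      _ = _ := by ring
  · intro hm0
    refine ⟨fun h => hcore.2 ⟨hsuff h.1, h.2⟩, ?_⟩
    rw [hcore]
    refine and_congr_left fun hL => ?_
    have hL' := (lintegral_mono_set hsub).trans_lt hL
    have hmeas : Measurable (fun z => z ^ (p - 1) * tau ν z) :=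
      (measurable_id.pow_const _).mul tau_meas
    have hK : 0 ≤ α / (-s (-1)) := div_nonneg hα0 hT1.le
    have key : ∀ z, 1 ≤ z → ∀ u v : ℝ, 0 ≤ v → u ≤ v + α * tau ν z →
        z ^ (p - 1) * u / |s (-z)| ≤ (1 + α / (-s (-1))) *
          (z ^ (p - 1) * tau ν z + z ^ (p - 1) * v / |s (-z)|) := by
      intro z hz u v hv huv
      have hz0 : 0 < z := hsub hz
      have h3 := s_neg hmono hs0 hz0
      have hT : s (-z) ≤ s (-1) := hmono.monotone (by linarith)
      rw [mul_div_assoc, mul_div_assoc, ← mul_add, mul_left_comm]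
      refine mul_le_mul_of_nonneg_left ?_ (by positivity)
      have ht := tau_nonneg (ν := ν) z
      have h8 : u / |s (-z)| ≤ v / |s (-z)| + α / (-s (-1)) * tau ν z := by
        calc u / |s (-z)| ≤ (v + α * tau ν z) / |s (-z)| := by gcongr
          _ = v / |s (-z)| + α * tau ν z / |s (-z)| := add_div _ _ _
          _ ≤ v / |s (-z)| + α * tau ν z / (-s (-1)) := by
            rw [abs_of_neg h3]
            gcongr
          _ = _ := by ring
      have h9 : 0 ≤ v / |s (-z)| := by positivity
      nlinarith [mul_nonneg hK h9]
    have hfacts : ∀ z, 1 ≤ z → 0 ≤ A - cY s ν (-z) ∧ cY s ν z ≤ A ∧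
        A - cY s ν z ≤ α * tau ν z := by
      intro z hz
      have h5 := cY_neg_leB (ν := ν) hs hint (y := -z) (by linarith)
      rw [← hB] at h5
      refine ⟨by linarith, cY_pos_leA hs hint (by linarith), ?_⟩
      refine (A_sub_cY (ν := ν) hs hint hmono hs0 hα (by linarith)).trans ?_
      refine mul_le_mul_of_nonneg_left ?_ hα0
      unfold tau; linarith [measureReal_nonneg (μ := ν) (s := Iic (-z))]
    constructor
    · intro hJ
      refine fin_of_le measurableSet_Ici (K := 1 + α / (-s (-1))) (by linarith) hmeas ?_ hL' hJ
      intro z hz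
      obtain ⟨f1, f2, f3⟩ := hfacts z hz
      refine key z hz _ _ f1 ?_
      rw [abs_le]; constructor <;> linarith
    · intro hJ
      refine fin_of_le measurableSet_Ici (K := 1 + α / (-s (-1))) (by linarith) hmeas ?_ hL' hJ
      intro z hz
      obtain ⟨f1, f2, f3⟩ := hfacts z hz
      refine key z hz _ _ (abs_nonneg _) ?_
      linarith [le_abs_self (cY s ν z - cY s ν (-z))]
end
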